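/- arXiv:2507.23392 — 6 statements merged into one kernel-verified Lean document; each statement's English description precedes it below -/
import Mathlib

section
/- Let X : [0,T] → ℝ^d be a continuously differentiable path, let I = (i_1,…,i_n) ∈ {1,…,d}^n be a multi-index, and let t ∈ [0,T]. Then Chen's identity holds: S(X)^{(i_1,…,i_n)}_{0,T} = Σ_{k=0}^{n} S(X)^{(i_1,…,i_k)}_{0,t} · S(X)^{(i_{k+1},…,i_n)}_{t,T}, where for k = 0 (resp. k = n) the first (resp. second) factor is the empty-index coefficient 1. -/
open MeasureTheory

/-- The signature coefficient `S(X)^I_{s,t}` of a path `X : ℝ → ℝ^d` over `[s,t]`,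
for a multi-index (word) `I = (i_1,…,i_n)`, defined as the iterated integral
`∫_{s<u_1<⋯<u_n<t} X'_{i_1}(u_1)⋯X'_{i_n}(u_n) du`; for `I = ∅` it equals `1`. -/
noncomputable def sigCoeff {d : ℕ} (X : ℝ → Fin d → ℝ) (s t : ℝ) (I : List (Fin d)) : ℝ :=
  ∫ u in {u : Fin I.length → ℝ |
      (∀ a b : Fin I.length, a < b → u a < u b) ∧ ∀ a, u a ∈ Set.Ioo s t},
    ∏ a : Fin I.length, deriv (fun r => X r (I.get a)) (u a)

/-- The open simplex `{s < u_1 < ⋯ < u_n < t}`. -/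
def openSimplex (n : ℕ) (s t : ℝ) : Set (Fin n → ℝ) :=
  {u | (∀ a b : Fin n, a < b → u a < u b) ∧ ∀ a, u a ∈ Set.Ioo s t}

lemma measurableSet_openSimplex (n : ℕ) (s t : ℝ) : MeasurableSet (openSimplex n s t) := by
  have h : openSimplex n s t =
      (⋂ a : Fin n, ⋂ b : Fin n, ⋂ _ : a < b, {u | u a < u b}) ∩
        ⋂ a : Fin n, {u | u a ∈ Set.Ioo s t} := by
    ext u
    simp [openSimplex]
  rw [h]
  refine MeasurableSet.inter ?_ ?_
  · exact MeasurableSet.iInter fun a => MeasurableSet.iInter fun b => MeasurableSet.iInter fun _ =>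
      measurableSet_lt (measurable_pi_apply a) (measurable_pi_apply b)
  · exact MeasurableSet.iInter fun a => measurable_pi_apply a measurableSet_Ioo

lemma integrableOn_openSimplex {n : ℕ} {g : (Fin n → ℝ) → ℝ} (hg : Continuous g) (s t : ℝ) :
    IntegrableOn g (openSimplex n s t) := by
  refine (hg.continuousOn.integrableOn_compact
    (isCompact_univ_pi fun _ : Fin n => isCompact_Icc (a := s) (b := t))).mono_set ?_
  exact fun u hu a _ => Set.Ioo_subset_Icc_self (hu.2 a)

lemma cons_mem_openSimplex {n : ℕ} {s t x : ℝ} {v : Fin n → ℝ} :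
    (Fin.cons x v : Fin (n + 1) → ℝ) ∈ openSimplex (n + 1) s t ↔
      x ∈ Set.Ioo s t ∧ v ∈ openSimplex n x t := by
  constructor
  · rintro ⟨h₁, h₂⟩
    refine ⟨h₂ 0, fun a b hab => ?_, fun a => ⟨?_, ?_⟩⟩
    · simpa using h₁ a.succ b.succ (Fin.succ_lt_succ_iff.2 hab)
    · simpa using h₁ 0 a.succ (Fin.succ_pos a)
    · simpa using (h₂ a.succ).2
  · rintro ⟨hx, h₁, h₂⟩
    refine ⟨fun a b hab => ?_, fun a => ?_⟩
    · induction b using Fin.cases with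
      | zero => exact absurd hab (Fin.not_lt_zero a)
      | succ b =>
        induction a using Fin.cases with
        | zero => simpa using (h₂ b).1
        | succ a => simpa using h₁ a b (Fin.succ_lt_succ_iff.1 hab)
    · induction a using Fin.cases with
      | zero => simpa using hx
      | succ a => simpa using ⟨hx.1.trans (h₂ a).1, (h₂ a).2⟩

/-- Fubini on the simplex: integrating out all but the smallest variable. -/
lemma integral_openSimplex_succ {n : ℕ} {f : Fin (n + 1) → ℝ → ℝ} (hf : ∀ a, Continuous (f a))
    (s t : ℝ) :
    IntegrableOn (fun x => f 0 x * ∫ v in openSimplex n x t, ∏ a : Fin n, f a.succ (v a))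
        (Set.Ioo s t) ∧
      ∫ u in openSimplex (n + 1) s t, ∏ a, f a (u a) =
        ∫ x in Set.Ioo s t, f 0 x * ∫ v in openSimplex n x t, ∏ a : Fin n, f a.succ (v a) := by
  set F : (Fin (n + 1) → ℝ) → ℝ :=
    (openSimplex (n + 1) s t).indicator fun u => ∏ a, f a (u a) with hF
  have hFint : Integrable F := (integrable_indicator_iff (measurableSet_openSimplex _ s t)).2 <|
    integrableOn_openSimplex
      (continuous_finsetProd _ fun a _ => (hf a).comp (continuous_apply a)) s t
  have hmp := (volume_preserving_piFinSuccAbove (fun _ : Fin (n + 1) => ℝ) 0).symm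
  have hsymm : ∀ p : ℝ × (Fin n → ℝ),
      (MeasurableEquiv.piFinSuccAbove (fun _ : Fin (n + 1) => ℝ) 0).symm p =
        (Fin.cons p.1 p.2 : Fin (n + 1) → ℝ) := fun p => by
    simp [MeasurableEquiv.piFinSuccAbove, Fin.insertNthEquiv]
  have hGint : Integrable (fun p : ℝ × (Fin n → ℝ) => F (Fin.cons p.1 p.2)) := by
    have h := (hmp.integrable_comp_emb (MeasurableEquiv.measurableEmbedding _)).2 hFint
    simpa only [Function.comp_def, hsymm] using h
  have hinner : (fun x => ∫ v : Fin n → ℝ, F (Fin.cons x v)) =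
      (Set.Ioo s t).indicator fun x =>
        f 0 x * ∫ v in openSimplex n x t, ∏ a : Fin n, f a.succ (v a) := by
    funext x
    by_cases hx : x ∈ Set.Ioo s t
    · rw [Set.indicator_of_mem hx, ← integral_const_mul,
        ← integral_indicator (measurableSet_openSimplex n x t)]
      congr 1 with v
      by_cases hv : v ∈ openSimplex n x t
      · rw [Set.indicator_of_mem hv, hF,
          Set.indicator_of_mem (cons_mem_openSimplex.2 ⟨hx, hv⟩), Fin.prod_univ_succ]
        simp
      · rw [Set.indicator_of_notMem hv, hF,
          Set.indicator_of_notMem fun h => hv (cons_mem_openSimplex.1 h).2]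
    · rw [Set.indicator_of_notMem hx]
      refine integral_eq_zero_of_ae (Filter.Eventually.of_forall fun v => ?_)
      exact Set.indicator_of_notMem (fun h => hx (cons_mem_openSimplex.1 h).1) _
  constructor
  · rw [← integrable_indicator_iff measurableSet_Ioo, ← hinner]
    exact Integrable.integral_prod_left hGint
  · rw [← integral_indicator (measurableSet_openSimplex _ s t),
      ← integral_indicator measurableSet_Ioo, ← hinner, ← hF,
      ← hmp.integral_comp (MeasurableEquiv.measurableEmbedding _)]
    simp only [hsymm]
    exact integral_prod _ hGint

lemma sigCoeff_nil {d : ℕ} (X : ℝ → Fin d → ℝ) (s t : ℝ) : sigCoeff X s t [] = 1 := by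
  have h : {u : Fin ([] : List (Fin d)).length → ℝ |
      (∀ a b : Fin ([] : List (Fin d)).length, a < b → u a < u b) ∧
        ∀ a, u a ∈ Set.Ioo s t} = Set.univ :=
    Set.eq_univ_of_forall fun _ => ⟨fun a => Fin.elim0 a, fun a => Fin.elim0 a⟩
  rw [sigCoeff, h]
  simp [Measure.real, volume_pi]

lemma sigCoeff_cons {d : ℕ} {X : ℝ → Fin d → ℝ} (hX : ContDiff ℝ 1 X) (i : Fin d)
    (I : List (Fin d)) (s t : ℝ) :
    IntegrableOn (fun x => deriv (fun r => X r i) x * sigCoeff X x t I) (Set.Ioc s t) ∧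
      sigCoeff X s t (i :: I) =
        ∫ x in Set.Ioc s t, deriv (fun r => X r i) x * sigCoeff X x t I := by
  rw [integrableOn_Ioc_iff_integrableOn_Ioo, integral_Ioc_eq_integral_Ioo]
  exact integral_openSimplex_succ
    (f := fun a : Fin (I.length + 1) => deriv fun r => X r ((i :: I).get a))
    (fun a => (contDiff_pi.1 hX _).continuous_deriv le_rfl) s t

/-- Chen's identity over an arbitrary interval `[s, T]`. -/
lemma sigCoeff_eq_sum {d : ℕ} {X : ℝ → Fin d → ℝ} (hX : ContDiff ℝ 1 X) (I : List (Fin d))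
    {t T : ℝ} (htT : t ≤ T) {s : ℝ} (hst : s ≤ t) :
    sigCoeff X s T I =
      ∑ k ∈ Finset.range (I.length + 1),
        sigCoeff X s t (I.take k) * sigCoeff X t T (I.drop k) := by
  induction I generalizing s with
  | nil => simp [sigCoeff_nil]
  | cons i I ih =>
    obtain ⟨hint, heq⟩ := sigCoeff_cons hX i I s T
    have hleft : ∫ x in Set.Ioc s t, deriv (fun r => X r i) x * sigCoeff X x T I =
        ∑ k ∈ Finset.range (I.length + 1),
          sigCoeff X s t (i :: I.take k) * sigCoeff X t T (I.drop k) := by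
      calc _ = ∫ x in Set.Ioc s t, ∑ k ∈ Finset.range (I.length + 1),
            deriv (fun r => X r i) x * sigCoeff X x t (I.take k) * sigCoeff X t T (I.drop k) := by
            refine setIntegral_congr_fun measurableSet_Ioc fun x hx => ?_
            simp only [ih hx.2, Finset.mul_sum, mul_assoc]
        _ = _ := by
            rw [integral_finsetSum _ fun k _ => (sigCoeff_cons hX i (I.take k) s t).1.mul_const _]
            refine Finset.sum_congr rfl fun k _ => ?_
            rw [integral_mul_const, ← (sigCoeff_cons hX i (I.take k) s t).2]
    rw [heq, ← Set.Ioc_union_Ioc_eq_Ioc hst htT,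
      setIntegral_union (Set.Ioc_disjoint_Ioc_of_le le_rfl) measurableSet_Ioc
        (hint.mono_set (Set.Ioc_subset_Ioc_right htT))
        (hint.mono_set (Set.Ioc_subset_Ioc_left hst)),
      hleft, ← (sigCoeff_cons hX i I t T).2, List.length_cons,
      Finset.sum_range_succ' _ (I.length + 1)]
    simp [sigCoeff_nil]


/-- **Chen's identity.** For a continuously differentiable path `X : [0,T] → ℝ^d`,
a multi-index `I = (i_1,…,i_n)` and `t ∈ [0,T]`,
`S(X)^{(i_1,…,i_n)}_{0,T} = Σ_{k=0}^{n} S(X)^{(i_1,…,i_k)}_{0,t} ⬝ S(X)^{(i_{k+1},…,i_n)}_{t,T}`. -/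
theorem chen_identity {d : ℕ} (T : ℝ) (hT : 0 ≤ T) (X : ℝ → Fin d → ℝ)
    (hX : ContDiff ℝ 1 X) (I : List (Fin d)) (t : ℝ) (ht : t ∈ Set.Icc (0:ℝ) T) :
    sigCoeff X 0 T I =
      ∑ k ∈ Finset.range (I.length + 1),
        sigCoeff X 0 t (I.take k) * sigCoeff X t T (I.drop k) := by
  exact sigCoeff_eq_sum hX I ht.2 ht.1
end

section
/- Let X : [0,T] → ℝ be a continuously differentiable path and k ≥ 1. Then for every t ∈ [0,T], the k-fold iterated integral satisfies ∫_{0<u_1<⋯<u_k<t} X'(u_1)⋯X'(u_k) du_1⋯du_k = (X_t − X_0)^k / k!. -/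
open MeasureTheory

/-- The open simplex `{0 < u_1 < ⋯ < u_k < t}`. -/
def openOrderedSimplex (k : ℕ) (t : ℝ) : Set (Fin k → ℝ) :=
  {u | (∀ i j : Fin k, i < j → u i < u j) ∧ ∀ i, u i ∈ Set.Ioo 0 t}

theorem measurableSet_openOrderedSimplex (k : ℕ) (t : ℝ) :
    MeasurableSet (openOrderedSimplex k t) := by
  have h : openOrderedSimplex k t =
      (⋂ i, ⋂ j, ⋂ _ : i < j, {u : Fin k → ℝ | u i < u j}) ∩
        ⋂ i, {u : Fin k → ℝ | u i ∈ Set.Ioo 0 t} := by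
    ext u
    simp [openOrderedSimplex]
  rw [h]
  refine .inter (.iInter fun i => .iInter fun j => .iInter fun _ => ?_) (.iInter fun i => ?_)
  · exact measurableSet_lt (measurable_pi_apply i) (measurable_pi_apply j)
  · exact measurable_pi_apply i measurableSet_Ioo

theorem integrableOn_openOrderedSimplex {f : ℝ → ℝ} (hf : Continuous f) (k : ℕ) (t : ℝ) :
    IntegrableOn (fun u : Fin k → ℝ => ∏ i, f (u i)) (openOrderedSimplex k t) := by
  have hc : Continuous fun u : Fin k → ℝ => ∏ i, f (u i) := by fun_prop
  refine (hc.continuousOn.integrableOn_compact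
    (isCompact_univ_pi fun _ : Fin k => isCompact_Icc (a := (0 : ℝ)) (b := t))).mono_set ?_
  exact fun u hu i _ => Set.Ioo_subset_Icc_self (hu.2 i)

theorem snoc_mem_openOrderedSimplex {k : ℕ} {t x : ℝ} {v : Fin k → ℝ} :
    (Fin.snoc v x : Fin (k + 1) → ℝ) ∈ openOrderedSimplex (k + 1) t ↔
      x ∈ Set.Ioo 0 t ∧ v ∈ openOrderedSimplex k x := by
  simp only [openOrderedSimplex, Set.mem_ofPred_eq, Fin.forall_fin_succ', Fin.snoc_castSucc,
    Fin.snoc_last, Fin.castSucc_lt_castSucc_iff, Fin.castSucc_lt_last, lt_irrefl,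
    Set.mem_Ioo, (Fin.castSucc_lt_last _).not_gt, forall_const, IsEmpty.forall_iff]
  constructor
  · rintro ⟨⟨h, -⟩, h', hx⟩
    exact ⟨hx, fun i => (h i).1, fun i => ⟨(h' i).1, (h i).2⟩⟩
  · rintro ⟨hx, h, h'⟩
    exact ⟨⟨fun i => ⟨h i, (h' i).2⟩, by simp⟩, fun i => ⟨(h' i).1, (h' i).2.trans hx.2⟩, hx⟩

theorem indicator_openOrderedSimplex_snoc (f : ℝ → ℝ) {k : ℕ} (t x : ℝ) (v : Fin k → ℝ) :
    (openOrderedSimplex (k + 1) t).indicator (fun u => ∏ i, f (u i)) (Fin.snoc v x) =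
      (Set.Ioo 0 t).indicator (fun x => f x *
        (openOrderedSimplex k x).indicator (fun v => ∏ i, f (v i)) v) x := by
  by_cases hx : x ∈ Set.Ioo 0 t <;> by_cases hv : v ∈ openOrderedSimplex k x <;>
    simp [Set.indicator, snoc_mem_openOrderedSimplex, hx, hv, Fin.prod_univ_castSucc, mul_comm,
      -Set.mem_Ioo]

theorem setIntegral_openOrderedSimplex_succ {f : ℝ → ℝ} (hf : Continuous f) (k : ℕ) (t : ℝ) :
    ∫ u in openOrderedSimplex (k + 1) t, ∏ i, f (u i) =
      ∫ x in Set.Ioo 0 t, f x * ∫ v in openOrderedSimplex k x, ∏ i, f (v i) := by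
  have hmp := (volume_preserving_piFinSuccAbove (fun _ : Fin (k + 1) => ℝ) (Fin.last k)).symm
  have hfint := (integrable_indicator_iff (measurableSet_openOrderedSimplex (k + 1) t)).2
    (integrableOn_openOrderedSimplex hf (k + 1) t)
  have hfcomp := (hmp.integrable_comp_emb (MeasurableEquiv.measurableEmbedding _)).2 hfint
  simp only [Function.comp_def] at hfcomp
  rw [← integral_indicator (measurableSet_openOrderedSimplex _ _),
    ← hmp.integral_comp (MeasurableEquiv.measurableEmbedding _), Measure.volume_eq_prod,
    integral_prod _ hfcomp,
    ← integral_indicator measurableSet_Ioo]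
  refine integral_congr_ae (.of_forall fun x => ?_)
  have key (v : Fin k → ℝ) :
      (openOrderedSimplex (k + 1) t).indicator (fun u => ∏ i, f (u i))
        ((MeasurableEquiv.piFinSuccAbove (fun _ => ℝ) (Fin.last k)).symm (x, v)) =
      (Set.Ioo 0 t).indicator (fun x => f x *
        (openOrderedSimplex k x).indicator (fun v => ∏ i, f (v i)) v) x := by
    refine (congrArg _ (Fin.insertNth_last' x v)).trans ?_
    exact indicator_openOrderedSimplex_snoc f t x v
  simp only [key]
  by_cases hx : x ∈ Set.Ioo 0 t
  · simp only [Set.indicator_of_mem hx, integral_const_mul,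
      integral_indicator (measurableSet_openOrderedSimplex _ _)]
  · simp [Set.indicator_of_notMem hx]

theorem setIntegral_openOrderedSimplex_deriv {X : ℝ → ℝ} (hX : ContDiff ℝ 1 X) (k : ℕ) {t : ℝ}
    (ht : 0 ≤ t) :
    ∫ u in openOrderedSimplex k t, ∏ i, deriv X (u i) = (X t - X 0) ^ k / (k.factorial : ℝ) := by
  have hc : Continuous (deriv X) := hX.continuous_deriv le_rfl
  induction k generalizing t with
  | zero =>
    have h : openOrderedSimplex 0 t = Set.univ := by ext; simp [openOrderedSimplex]
    simp [h, measureReal_def, volume_pi]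
  | succ k ih =>
    have hd (x : ℝ) : HasDerivAt (fun x => (X x - X 0) ^ (k + 1) / ((k + 1).factorial : ℝ))
        (deriv X x * ((X x - X 0) ^ k / (k.factorial : ℝ))) x := by
      have h := (hX.differentiable one_ne_zero x).hasDerivAt
      refine (((h.sub_const (X 0)).pow (k + 1)).div_const
        ((k + 1).factorial : ℝ)).congr_deriv ?_
      rw [Nat.factorial_succ, Nat.add_sub_cancel]
      push_cast
      field_simp
    have hX' := hX.continuous
    rw [setIntegral_openOrderedSimplex_succ hc, setIntegral_congr_fun measurableSet_Ioo
      fun x hx => congrArg (deriv X x * ·) (ih hx.1.le), ← integral_Ioc_eq_integral_Ioo,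
      ← intervalIntegral.integral_of_le ht,
      intervalIntegral.integral_eq_sub_of_hasDerivAt (fun x _ => hd x)
        (Continuous.intervalIntegrable (by fun_prop) _ _)]
    simp

/-- For a continuously differentiable one-dimensional path `X : [0,T] → ℝ` and `k ≥ 1`,
the `k`-fold iterated integral over the open simplex `{0 < u_1 < ⋯ < u_k < t}` equals
`(X_t − X_0)^k / k!`. -/
theorem iterated_integral_one_dim (T : ℝ) (hT : 0 ≤ T) (X : ℝ → ℝ) (hX : ContDiff ℝ 1 X)
    (k : ℕ) (hk : 1 ≤ k) (t : ℝ) (ht : t ∈ Set.Icc (0:ℝ) T) :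
    (∫ u in {u : Fin k → ℝ |
        (∀ i j : Fin k, i < j → u i < u j) ∧ ∀ i, u i ∈ Set.Ioo 0 t},
      ∏ i : Fin k, deriv X (u i)) = (X t - X 0) ^ k / (Nat.factorial k : ℝ) := by
  exact setIntegral_openOrderedSimplex_deriv hX k ht.1
end

section
/- Let V be a finite-dimensional real vector space, N ≥ 1, and let X, Y : Δ_T → T^N(V) be multiplicative functionals of degree N such that π_k(X_{s,t}) = π_k(Y_{s,t}) for all 0 ≤ k ≤ N−1 and all (s,t) ∈ Δ_T. Then the map Ψ : Δ_T → V^{⊗N} defined by Ψ_{s,t} = π_N(X_{s,t}) − π_N(Y_{s,t}) is additive: Ψ_{s,t} = Ψ_{s,u} + Ψ_{u,t} for all 0 ≤ s ≤ u ≤ t ≤ T. -/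
/-- The coordinate model of the `k`-th tensor power `V^{⊗k}` of `V = ℝ^d`:
real-valued functions on multi-indices `(i_1,…,i_k) ∈ {1,…,d}^k`. -/
abbrev Tens (d k : ℕ) := (Fin k → Fin d) → ℝ

/-- The graded product `(a ⊗ b)_n = Σ_{i+j=n} a_i ⊗ b_j` on ℕ-graded tensors in
coordinates, using the canonical identification `V^{⊗i} ⊗ V^{⊗j} ≅ V^{⊗(i+j)}`. -/
noncomputable def etMul {d : ℕ} (a b : ∀ n : ℕ, Tens d n) : ∀ n : ℕ, Tens d n :=
  fun n w => ∑ i : Fin (n + 1),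
    a (i : ℕ) (fun x => w ⟨(x : ℕ), by have := x.isLt; have := i.isLt; omega⟩) *
    b (n - (i : ℕ)) (fun y => w ⟨(i : ℕ) + (y : ℕ), by have := y.isLt; omega⟩)

/-- The truncated tensor algebra `T^N(V) = ⊕_{k=0}^N V^{⊗k}` over `V = ℝ^d`,
in coordinates. -/
abbrev TTA (d N : ℕ) := ∀ k : Fin (N + 1), Tens d k

/-- Extension of an element of `T^N(V)` by zero to all degrees. -/
def extendTTA {d N : ℕ} (a : TTA d N) : ∀ n : ℕ, Tens d n :=
  fun n => if h : n < N + 1 then a ⟨n, h⟩ else 0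

/-- The truncated tensor product on `T^N(V)`: `(a ⊗ b)_n = Σ_{i+j=n} a_i ⊗ b_j`
for `n ≤ N`. -/
noncomputable def ttaMul {d N : ℕ} (a b : TTA d N) : TTA d N :=
  fun k => etMul (extendTTA a) (extendTTA b) (k : ℕ)

/-- The simplex `Δ_T = {(s,t) : 0 ≤ s ≤ t ≤ T}`. -/
def DeltaSet (T : ℝ) : Set (ℝ × ℝ) := {q | 0 ≤ q.1 ∧ q.1 ≤ q.2 ∧ q.2 ≤ T}

/-- A multiplicative functional of degree `N`: a continuous map `X : Δ_T → T^N(V)`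
with `π_0(X_{s,t}) = 1` and `X_{s,t} = X_{s,u} ⊗ X_{u,t}` for all `0 ≤ s ≤ u ≤ t ≤ T`. -/
def IsMultFunc {d N : ℕ} (T : ℝ) (X : ℝ × ℝ → TTA d N) : Prop :=
  ContinuousOn X (DeltaSet T) ∧
  (∀ s t : ℝ, (s, t) ∈ DeltaSet T → X (s, t) 0 = fun _ => 1) ∧
  (∀ s u t : ℝ, 0 ≤ s → s ≤ u → u ≤ t → t ≤ T →
    X (s, t) = ttaMul (X (s, u)) (X (u, t)))

theorem extendTTA_apply_zero {d N : ℕ} {a : TTA d N} (ha : a 0 = fun _ => 1) {m : ℕ}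
    (hm : m = 0) (v : Fin m → Fin d) : extendTTA a m v = 1 := by
  subst hm
  have h : extendTTA a 0 = a 0 := dif_pos (Nat.succ_pos N)
  rw [h, ha]

theorem extendTTA_congr {d N : ℕ} {a b : TTA d N}
    (h : ∀ k : Fin (N + 1), (k : ℕ) ≤ N - 1 → a k = b k) {m : ℕ} (hm : m ≤ N - 1) :
    extendTTA a m = extendTTA b m := by
  have hmN : m < N + 1 := by omega
  simpa only [extendTTA, dif_pos hmN] using h ⟨m, hmN⟩ hm

theorem extendTTA_top {d N : ℕ} (a : TTA d N) : extendTTA a N = a (Fin.last N) :=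
  dif_pos (Nat.lt_succ_self N)

/-- The product of two elements with unit scalar part splits off its two extreme terms. -/
theorem ttaMul_last_apply {d M : ℕ} {a b : TTA d (M + 1)} (ha : a 0 = fun _ => 1)
    (hb : b 0 = fun _ => 1) (w : Fin (M + 1) → Fin d) :
    ttaMul a b (Fin.last (M + 1)) w = b (Fin.last (M + 1)) w +
      ((∑ i : Fin M,
        extendTTA a ((i : ℕ) + 1) (fun x => w ⟨x, by have := x.isLt; have := i.isLt; omega⟩) *
        extendTTA b (M + 1 - ((i : ℕ) + 1))
          (fun y => w ⟨(i : ℕ) + 1 + y, by have := y.isLt; omega⟩)) +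
        a (Fin.last (M + 1)) w) := by
  change etMul (extendTTA a) (extendTTA b) (M + 1) w = _
  rw [etMul, Fin.sum_univ_succ, Fin.sum_univ_castSucc]
  congr 1
  · rw [extendTTA_apply_zero ha (Fin.val_zero _), one_mul, ← extendTTA_top b]
    change extendTTA b (M + 1) _ = _
    congr 1
    funext y
    congr 1
    exact Fin.ext (Nat.zero_add _)
  · congr 1
    rw [extendTTA_apply_zero hb (by simp), mul_one, ← extendTTA_top a]
    rfl

theorem ttaMul_last_sub {d N : ℕ} (hN : 1 ≤ N) {a b a' b' : TTA d N}
    (ha : a 0 = fun _ => 1) (hb : b 0 = fun _ => 1)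
    (haa' : ∀ k : Fin (N + 1), (k : ℕ) ≤ N - 1 → a k = a' k)
    (hbb' : ∀ k : Fin (N + 1), (k : ℕ) ≤ N - 1 → b k = b' k) :
    ttaMul a b (Fin.last N) - ttaMul a' b' (Fin.last N) =
      (a (Fin.last N) - a' (Fin.last N)) + (b (Fin.last N) - b' (Fin.last N)) := by
  obtain ⟨M, rfl⟩ := Nat.exists_eq_add_of_le' hN
  have ha' := (haa' 0 (Nat.zero_le _)).symm.trans ha
  have hb' := (hbb' 0 (Nat.zero_le _)).symm.trans hb
  funext w
  simp only [Pi.sub_apply, Pi.add_apply]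
  rw [ttaMul_last_apply ha hb, ttaMul_last_apply ha' hb', Finset.sum_congr rfl fun i _ => by
    rw [extendTTA_congr haa' (by have := i.isLt; omega : (i : ℕ) + 1 ≤ M + 1 - 1),
      extendTTA_congr hbb' (by omega : M + 1 - ((i : ℕ) + 1) ≤ M + 1 - 1)]]
  ring

/-- **Difference of top levels is additive.** If `X, Y : Δ_T → T^N(V)` are multiplicative
functionals of degree `N` agreeing on levels `0,…,N−1`, then
`Ψ_{s,t} = π_N(X_{s,t}) − π_N(Y_{s,t})` is additive: `Ψ_{s,t} = Ψ_{s,u} + Ψ_{u,t}`. -/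
theorem top_level_difference_additive {d N : ℕ} (hN : 1 ≤ N) (T : ℝ)
    (X Y : ℝ × ℝ → TTA d N) (hX : IsMultFunc T X) (hY : IsMultFunc T Y)
    (hagree : ∀ k : Fin (N + 1), (k : ℕ) ≤ N - 1 → ∀ q ∈ DeltaSet T, X q k = Y q k) :
    ∀ s u t : ℝ, 0 ≤ s → s ≤ u → u ≤ t → t ≤ T →
      X (s, t) (Fin.last N) - Y (s, t) (Fin.last N) =
        (X (s, u) (Fin.last N) - Y (s, u) (Fin.last N)) +
          (X (u, t) (Fin.last N) - Y (u, t) (Fin.last N)) := by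
  intro s u t hs hsu hut htT
  obtain ⟨-, hX0, hXmul⟩ := hX
  obtain ⟨-, -, hYmul⟩ := hY
  have hsu_mem : (s, u) ∈ DeltaSet T := ⟨hs, hsu, hut.trans htT⟩
  have hut_mem : (u, t) ∈ DeltaSet T := ⟨hs.trans hsu, hut, htT⟩
  rw [hXmul s u t hs hsu hut htT, hYmul s u t hs hsu hut htT]
  exact ttaMul_last_sub hN (hX0 s u hsu_mem) (hX0 u t hut_mem)
    (fun k hk => hagree k hk _ hsu_mem) (fun k hk => hagree k hk _ hut_mem)
end

section
/- Fix x_0 ∈ ℝ^d, and let K be a compact set of continuously differentiable paths X : [0,T] → ℝ^d with X_0 = x_0, where the space of such paths carries the metric d(X,Y) = sup_{t∈[0,T]} ‖X_t − Y_t‖ + sup_{t∈[0,T]} ‖X'_t − Y'_t‖. Let f : K → ℝ be continuous. Then for every ε > 0 there exist finitely many multi-indices I over the alphabet {0,1,…,d} and real coefficients ℓ_I such that sup_{X ∈ K} | f(X) − Σ_I ℓ_I S(X̂)^I_{0,T} | < ε. (First universal approximation theorem, for time-augmented signatures.) -/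
open MeasureTheory

/-- The time-augmented path `X̂_t = (t, X_t) ∈ ℝ^{1+d}`, with coordinate `0` being time. -/
noncomputable def timeAug {d : ℕ} (X : ℝ → Fin d → ℝ) : ℝ → Fin (d + 1) → ℝ :=
  fun t => Fin.cons t (X t)

/-- The space of continuously differentiable paths `ℝ → ℝ^d`. -/
abbrev C1Path (d : ℕ) := {f : ℝ → Fin d → ℝ // ContDiff ℝ 1 f}

/-- The data `(X|_{[0,T]}, X'|_{[0,T]})` of a `C¹` path, as a pair of continuous maps on
`[0,T]`; the `C¹` metric `d(X,Y) = sup_{[0,T]} ‖X−Y‖ + sup_{[0,T]} ‖X'−Y'‖` induces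
exactly the topology pulled back through this map. -/
noncomputable def toC1Data (d : ℕ) (T : ℝ) (X : C1Path d) :
    C(Set.Icc (0:ℝ) T, Fin d → ℝ) × C(Set.Icc (0:ℝ) T, Fin d → ℝ) :=
  (⟨fun u => X.1 u, X.2.continuous.comp continuous_subtype_val⟩,
   ⟨fun u => deriv X.1 u, (X.2.continuous_deriv le_rfl).comp continuous_subtype_val⟩)

/-- The topology of the `C¹` metric `d(X,Y) = sup_{[0,T]} ‖X−Y‖ + sup_{[0,T]} ‖X'−Y'‖`
on the space of `C¹` paths. -/
noncomputable def pathTopology (d : ℕ) (T : ℝ) : TopologicalSpace (C1Path d) :=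
  TopologicalSpace.induced (toC1Data d T) inferInstance

open Set Topology

/-- The iterated integral over `[s, T]` of the functions `g i`, `i` ranging over the letters of a
word, with the first letter of the word integrated last. -/
noncomputable def iterInt {ι : Type*} (g : ι → ℝ → ℝ) (T : ℝ) : List ι → ℝ → ℝ
  | [], _ => 1
  | i :: I, s => ∫ u in s..T, g i u * iterInt g T I u

section iterInt

variable {ι : Type*} {g h : ι → ℝ → ℝ} {T : ℝ}

theorem iterInt_nil (g : ι → ℝ → ℝ) (T s : ℝ) : iterInt g T [] s = 1 := rfl

theorem iterInt_cons (g : ι → ℝ → ℝ) (T : ℝ) (i : ι) (I : List ι) (s : ℝ) :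
    iterInt g T (i :: I) s = ∫ u in s..T, g i u * iterInt g T I u := rfl

theorem iterInt_congr {a : ℝ} (hgh : ∀ i, ∀ u ∈ Icc a T, g i u = h i u) (I : List ι) :
    ∀ s ∈ Icc a T, iterInt g T I s = iterInt h T I s := by
  induction I with
  | nil => intro s _; rfl
  | cons i I ih =>
    intro s hs
    refine intervalIntegral.integral_congr fun u hu => ?_
    rw [uIcc_of_le hs.2] at hu
    have hu' : u ∈ Icc a T := ⟨hs.1.trans hu.1, hu.2⟩
    simp only [hgh i u hu', ih u hu']

theorem continuous_iterInt_parametric {P : Type*} [TopologicalSpace P] {γ : P → ι → ℝ → ℝ}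
    (hγ : ∀ i, Continuous fun p : P × ℝ => γ p.1 i p.2) (T : ℝ) (I : List ι) :
    Continuous fun p : P × ℝ => iterInt (γ p.1) T I p.2 := by
  induction I with
  | nil => exact continuous_const
  | cons i I ih =>
    simp only [iterInt_cons, intervalIntegral.integral_symm T]
    exact (intervalIntegral.continuous_parametric_primitive_of_continuous
      (f := fun p u => γ p i u * iterInt (γ p) T I u) ((hγ i).mul ih)).neg

theorem continuous_iterInt (hg : ∀ i, Continuous (g i)) (T : ℝ) (I : List ι) :
    Continuous (iterInt g T I) :=
  (continuous_iterInt_parametric (γ := fun _ : Unit => g)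
    (fun i => (hg i).comp continuous_snd) T I).comp (Continuous.prodMk_right ())

theorem hasDerivAt_iterInt_cons (hg : ∀ i, Continuous (g i)) (T : ℝ) (i : ι) (I : List ι)
    (s : ℝ) : HasDerivAt (iterInt g T (i :: I)) (-(g i s * iterInt g T I s)) s := by
  have hc : Continuous fun u => g i u * iterInt g T I u := (hg i).mul (continuous_iterInt hg T I)
  exact intervalIntegral.integral_hasDerivAt_left (hc.intervalIntegrable _ _)
    (hc.stronglyMeasurableAtFilter _ _) hc.continuousAt

theorem iterInt_cons_mul_cons (hg : ∀ i, Continuous (g i)) (T : ℝ) (i j : ι) (I J : List ι)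
    (s : ℝ) :
    iterInt g T (i :: I) s * iterInt g T (j :: J) s =
      (∫ u in s..T, g i u * (iterInt g T I u * iterInt g T (j :: J) u)) +
        ∫ u in s..T, g j u * (iterInt g T (i :: I) u * iterInt g T J u) := by
  have hc := continuous_iterInt hg T
  have h₁ : Continuous fun u => g i u * (iterInt g T I u * iterInt g T (j :: J) u) :=
    (hg i).mul ((hc _).mul (hc _))
  have h₂ : Continuous fun u => g j u * (iterInt g T (i :: I) u * iterInt g T J u) :=
    (hg j).mul ((hc _).mul (hc _))
  rw [← intervalIntegral.integral_add (h₁.intervalIntegrable _ _) (h₂.intervalIntegrable _ _)]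
  have key := intervalIntegral.integral_eq_sub_of_hasDerivAt (a := s) (b := T)
    (fun u _ => ((hasDerivAt_iterInt_cons hg T i I u).mul
      (hasDerivAt_iterInt_cons hg T j J u)).neg)
    ((((((hg i).mul (hc I)).neg.mul (hc (j :: J))).add
      ((hc (i :: I)).mul ((hg j).mul (hc J)).neg)).neg).intervalIntegrable _ _)
  have hT : iterInt g T (i :: I) T = 0 := by simp [iterInt_cons]
  simp only [Pi.neg_apply, Pi.mul_apply, hT, zero_mul, neg_zero, zero_sub, neg_neg] at key
  rw [← key]
  exact intervalIntegral.integral_congr fun u _ => by ring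

theorem sum_map_iterInt_map_cons (hg : ∀ i, Continuous (g i)) (T : ℝ) (i : ι)
    (L : List (List ι)) (s : ℝ) :
    ((L.map (List.cons i)).map fun W => iterInt g T W s).sum =
      ∫ u in s..T, g i u * (L.map fun W => iterInt g T W u).sum := by
  have hc := continuous_iterInt hg T
  induction L with
  | nil => simp
  | cons W L ih =>
    have hL : Continuous fun u => (L.map fun W => iterInt g T W u).sum :=
      continuous_list_sum L fun W _ => hc W
    simp only [List.map_cons, List.sum_cons, mul_add]
    have hW : Continuous fun u => g i u * iterInt g T W u := (hg i).mul (hc W)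
    have hiL : Continuous fun u => g i u * (L.map fun W => iterInt g T W u).sum := (hg i).mul hL
    rw [intervalIntegral.integral_add (hW.intervalIntegrable _ _) (hiL.intervalIntegrable _ _),
      ih, iterInt_cons]

/-- A product of iterated integrals is a sum of iterated integrals, over the shuffles of the two
words. -/
theorem exists_iterInt_mul_eq_sum (I J : List ι) :
    ∃ L : List (List ι), ∀ (g : ι → ℝ → ℝ), (∀ i, Continuous (g i)) → ∀ T s : ℝ,
      iterInt g T I s * iterInt g T J s = (L.map fun W => iterInt g T W s).sum := by
  induction I generalizing J with
  | nil => exact ⟨[J], fun g _ T s => by simp [iterInt_nil]⟩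
  | cons i I ihI =>
    induction J with
    | nil => exact ⟨[i :: I], fun g _ T s => by simp [iterInt_nil]⟩
    | cons j J ihJ =>
      obtain ⟨L₁, h₁⟩ := ihI (j :: J)
      obtain ⟨L₂, h₂⟩ := ihJ
      refine ⟨L₁.map (List.cons i) ++ L₂.map (List.cons j), fun g hg T s => ?_⟩
      rw [List.map_append, List.sum_append, sum_map_iterInt_map_cons hg,
        sum_map_iterInt_map_cons hg, iterInt_cons_mul_cons hg]
      simp only [h₁ g hg T, h₂ g hg T]

theorem iterInt_replicate {o : ι} (ho : ∀ u, g o u = 1) (T : ℝ) (k : ℕ) (s : ℝ) :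
    iterInt g T (List.replicate k o) s = (T - s) ^ k / k.factorial := by
  induction k generalizing s with
  | zero => simp [iterInt_nil]
  | succ k ih =>
    rw [List.replicate_succ, iterInt_cons]
    simp only [ho, ih, one_mul, intervalIntegral.integral_div]
    rw [intervalIntegral.integral_comp_sub_left (fun x => x ^ k), integral_pow]
    simp only [sub_self, Nat.factorial_succ]
    push_cast
    field_simp
    simp

end iterInt

/-- A continuous function on `[0, T]` all of whose moments vanish is zero. -/
theorem eq_zero_of_forall_integral_mul_pow_eq_zero {q : ℝ → ℝ} (hq : Continuous q) {T : ℝ}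
    (hT : 0 < T) (h : ∀ k : ℕ, ∫ u in (0 : ℝ)..T, q u * (T - u) ^ k = 0) :
    ∀ u ∈ Icc 0 T, q u = 0 := by
  have hpoly (p : Polynomial ℝ) : ∫ u in (0 : ℝ)..T, q u * p.eval (T - u) = 0 := by
    simp only [Polynomial.eval_eq_sum_range, Finset.mul_sum]
    rw [intervalIntegral.integral_finsetSum
      fun k _ => Continuous.intervalIntegrable (by fun_prop) _ _]
    refine Finset.sum_eq_zero fun k _ => ?_
    simp only [mul_left_comm (q _), intervalIntegral.integral_const_mul, h, mul_zero]
  have hsq : ∫ u in (0 : ℝ)..T, q u * q u ≤ 0 := by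
    set M := ∫ u in (0 : ℝ)..T, |q u| with hM
    have hM0 : 0 ≤ M := intervalIntegral.integral_nonneg hT.le fun u _ => abs_nonneg _
    refine le_of_forall_pos_le_add fun ε hε => ?_
    obtain ⟨p, hp⟩ := exists_polynomial_near_of_continuousOn 0 T (fun v => q (T - v))
      (by fun_prop) (ε / (M + 1)) (by positivity)
    calc ∫ u in (0 : ℝ)..T, q u * q u
        = ∫ u in (0 : ℝ)..T, q u * (q u - p.eval (T - u)) := by
          simp only [mul_sub]
          rw [intervalIntegral.integral_sub (Continuous.intervalIntegrable (by fun_prop) _ _)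
            (Continuous.intervalIntegrable (by fun_prop) _ _), hpoly, sub_zero]
      _ ≤ ∫ u in (0 : ℝ)..T, |q u| * (ε / (M + 1)) := by
          refine intervalIntegral.integral_mono_on hT.le
            (Continuous.intervalIntegrable (by fun_prop) _ _)
            (Continuous.intervalIntegrable (by fun_prop) _ _) fun u hu => ?_
          refine (le_abs_self _).trans ?_
          rw [abs_mul]
          have := hp (T - u) ⟨by linarith [hu.2], by linarith [hu.1]⟩
          rw [sub_sub_cancel, abs_sub_comm] at this
          gcongr
      _ = M / (M + 1) * ε := by rw [intervalIntegral.integral_mul_const, ← hM]; ring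
      _ ≤ 1 * ε := by gcongr; exact (div_le_one (by positivity)).2 (by linarith)
      _ = 0 + ε := by ring
  by_contra! ⟨u, hu, hne⟩
  exact hsq.not_gt (intervalIntegral.integral_pos hT (hq.mul hq).continuousOn
    (fun x _ => mul_self_nonneg _) ⟨u, hu, mul_self_pos.2 hne⟩)

theorem cons_mem_simplex_iff {n : ℕ} {s t x : ℝ} {v : Fin n → ℝ} :
    ((∀ a b : Fin (n + 1), a < b →
        (Fin.cons x v : Fin (n + 1) → ℝ) a < (Fin.cons x v : Fin (n + 1) → ℝ) b) ∧
      ∀ a, (Fin.cons x v : Fin (n + 1) → ℝ) a ∈ Ioo s t) ↔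
    x ∈ Ioo s t ∧ (∀ a b : Fin n, a < b → v a < v b) ∧ ∀ a, v a ∈ Ioo x t := by
  simp only [Fin.forall_fin_succ, Fin.cons_zero, Fin.cons_succ, mem_Ioo, Fin.succ_lt_succ_iff,
    Fin.succ_pos, Fin.not_lt_zero, forall_true_left, false_imp_iff, true_and]
  constructor
  · rintro ⟨⟨h₁, h₂⟩, h₃, h₄⟩
    exact ⟨h₃, h₂, fun a => ⟨h₁ a, (h₄ a).2⟩⟩
  · rintro ⟨h₃, h₂, h₁⟩
    exact ⟨⟨fun a => (h₁ a).1, h₂⟩, h₃, fun a => ⟨h₃.1.trans (h₁ a).1, (h₁ a).2⟩⟩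

theorem measurableSet_simplex (n : ℕ) (s t : ℝ) :
    MeasurableSet {u : Fin n → ℝ | (∀ a b : Fin n, a < b → u a < u b) ∧ ∀ a, u a ∈ Ioo s t} := by
  measurability

/-- Fubini's theorem on the simplex, integrating over the smallest variable last. -/
theorem setIntegral_simplex_succ {n : ℕ} {φ : Fin (n + 1) → ℝ → ℝ} (hφ : ∀ a, Continuous (φ a))
    {s t : ℝ} (hst : s ≤ t) :
    ∫ u in {u : Fin (n + 1) → ℝ | (∀ a b, a < b → u a < u b) ∧ ∀ a, u a ∈ Ioo s t},
        ∏ a, φ a (u a) =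
      ∫ x in s..t, φ 0 x *
        ∫ v in {v : Fin n → ℝ | (∀ a b, a < b → v a < v b) ∧ ∀ a, v a ∈ Ioo x t},
          ∏ a : Fin n, φ a.succ (v a) := by
  set S := {u : Fin (n + 1) → ℝ | (∀ a b, a < b → u a < u b) ∧ ∀ a, u a ∈ Ioo s t} with hS
  have hSm : MeasurableSet S := measurableSet_simplex _ s t
  have hcont : Continuous fun u : Fin (n + 1) → ℝ => ∏ a, φ a (u a) :=
    continuous_finsetProd _ fun a _ => (hφ a).comp (continuous_apply a)
  have hint : IntegrableOn (fun u : Fin (n + 1) → ℝ => ∏ a, φ a (u a)) S :=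
    (hcont.continuousOn.integrableOn_compact
      (isCompact_univ_pi fun _ : Fin (n + 1) => isCompact_Icc (a := s) (b := t))).mono_set
      fun u hu a _ => Ioo_subset_Icc_self (hu.2 a)
  have hmp := (volume_preserving_piFinSuccAbove (fun _ : Fin (n + 1) => ℝ) 0).symm
  have happ (z : ℝ × (Fin n → ℝ)) :
      (MeasurableEquiv.piFinSuccAbove (fun _ : Fin (n + 1) => ℝ) 0).symm z =
        (Fin.cons z.1 z.2 : Fin (n + 1) → ℝ) := by
    rw [MeasurableEquiv.piFinSuccAbove_symm_apply]
    exact Fin.insertNth_zero' _ _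
  rw [← integrable_indicator_iff hSm,
    ← hmp.integrable_comp_emb (MeasurableEquiv.measurableEmbedding _)] at hint
  rw [← integral_indicator hSm, ← hmp.integral_comp (MeasurableEquiv.measurableEmbedding _)]
  rw [Measure.volume_eq_prod]
  refine (integral_prod _ hint).trans ?_
  rw [intervalIntegral.integral_of_le hst,
    integral_Ioc_eq_integral_Ioo, ← integral_indicator measurableSet_Ioo]
  refine integral_congr_ae (.of_forall fun x => ?_)
  simp only [Function.comp_apply, happ, indicator_apply, hS, mem_ofPred_eq, cons_mem_simplex_iff,
    Fin.prod_univ_succ, Fin.cons_zero, Fin.cons_succ]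
  by_cases hx : x ∈ Ioo s t
  · simp only [hx, true_and, if_true]
    rw [← integral_const_mul, ← integral_indicator (measurableSet_simplex n x t)]
    simp only [indicator_apply, mem_ofPred_eq]
  · simp [hx]

theorem sigCoeff_eq_iterInt {d : ℕ} {X : ℝ → Fin d → ℝ}
    (hX : ∀ i, Continuous (deriv fun r => X r i)) (T : ℝ) (I : List (Fin d)) :
    ∀ s ≤ T, sigCoeff X s T I = iterInt (fun i => deriv fun r => X r i) T I s := by
  induction I with
  | nil =>
    intro s _
    have : {u : Fin ([] : List (Fin d)).length → ℝ | (∀ a b, a < b → u a < u b) ∧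
        ∀ a, u a ∈ Ioo s T} = univ :=
      eq_univ_of_forall fun u => ⟨fun a => a.elim0, fun a => a.elim0⟩
    simp only [sigCoeff, iterInt_nil, this]
    simp [volume_pi, Measure.real]
  | cons i I ih =>
    intro s hs
    rw [iterInt_cons]
    refine (setIntegral_simplex_succ (n := I.length)
      (φ := fun a => deriv fun r => X r ((i :: I).get a)) (fun a => hX _) hs).trans ?_
    refine intervalIntegral.integral_congr fun u hu => ?_
    rw [uIcc_of_le hs] at hu
    simp only [← ih u hu.2]
    rfl

/-- Stone–Weierstrass without point separation: a continuous function that is constant on the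
sets of points not separated by `A` lies in the uniform closure of `A`. -/
theorem exists_mem_subalgebra_near_of_forall_eq {P : Type*} [TopologicalSpace P] [CompactSpace P]
    (A : Subalgebra ℝ C(P, ℝ)) (f : C(P, ℝ)) (hf : ∀ p q, (∀ a ∈ A, a p = a q) → f p = f q)
    {ε : ℝ} (hε : 0 < ε) : ∃ a ∈ A, ∀ p, |f p - a p| < ε := by
  let r : Setoid P :=
    { r := fun p q => ∀ a ∈ A, a p = a q
      iseqv := ⟨fun _ _ _ => rfl, fun h a ha => (h a ha).symm,
        fun h₁ h₂ a ha => (h₁ a ha).trans (h₂ a ha)⟩ }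
  let π : C(P, Quotient r) := ⟨Quotient.mk r, continuous_quotient_mk'⟩
  let B := A.comap (ContinuousMap.compRightAlgHom ℝ ℝ π)
  have hB : B.SeparatesPoints := by
    intro x y
    induction x using Quotient.inductionOn with | _ p
    induction y using Quotient.inductionOn with | _ q
    intro hne
    have : ¬ ∀ a ∈ A, a p = a q := fun h => hne (Quotient.sound h)
    push Not at this
    obtain ⟨a, ha, hpq⟩ := this
    let b : C(Quotient r, ℝ) :=
      ⟨Quotient.lift a fun p q h => h a ha, a.continuous.quotient_lift _⟩
    have hab : ContinuousMap.compRightAlgHom ℝ ℝ π b = a := ContinuousMap.ext fun _ => rfl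
    refine ⟨b, ⟨b, ?_, rfl⟩, hpq⟩
    change ContinuousMap.compRightAlgHom ℝ ℝ π b ∈ A
    rwa [hab]
  obtain ⟨b, hb⟩ := ContinuousMap.exists_mem_subalgebra_near_continuous_of_separatesPoints B hB
    (Quotient.lift f hf) (f.continuous.quotient_lift _) ε hε
  refine ⟨_, b.2, fun p => ?_⟩
  rw [abs_sub_comm]
  exact hb (Quotient.mk r p)

/-- Universal approximation by iterated integrals, for a compact family of continuous integrands
one of which is constantly `1`. -/
theorem exists_sum_iterInt_near {ι P : Type*} [TopologicalSpace P] [CompactSpace P]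
    {γ : P → ι → ℝ → ℝ} (hγ : ∀ i, Continuous fun p : P × ℝ => γ p.1 i p.2) {o : ι}
    (ho : ∀ p u, γ p o u = 1) {T : ℝ} (hT : 0 < T) (f : C(P, ℝ))
    (hf : ∀ p q, (∀ i, ∀ u ∈ Icc 0 T, γ p i u = γ q i u) → f p = f q) {ε : ℝ} (hε : 0 < ε) :
    ∃ c : List ι →₀ ℝ, ∀ p, |f p - ∑ I ∈ c.support, c I * iterInt (γ p) T I 0| < ε := by
  have hγp (p : P) (i : ι) : Continuous (γ p i) := (hγ i).comp (Continuous.prodMk_right p)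
  let w (I : List ι) : C(P, ℝ) := ⟨fun p => iterInt (γ p) T I 0,
    (continuous_iterInt_parametric hγ T I).comp (Continuous.prodMk_left 0)⟩
  have h_one : 1 ∈ Submodule.span ℝ (range w) := Submodule.subset_span ⟨[], rfl⟩
  have h_mul (x y : C(P, ℝ)) (hx : x ∈ Submodule.span ℝ (range w))
      (hy : y ∈ Submodule.span ℝ (range w)) : x * y ∈ Submodule.span ℝ (range w) := by
    have hxy := Submodule.mul_mem_mul hx hy
    rw [Submodule.span_mul_span] at hxy
    refine Submodule.span_le.2 ?_ hxy
    rintro _ ⟨_, ⟨I, rfl⟩, _, ⟨J, rfl⟩, rfl⟩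
    obtain ⟨L, hL⟩ := exists_iterInt_mul_eq_sum I J
    have hw : w I * w J = (L.map w).sum := by
      ext p
      have hp : ∀ L : List (List ι),
          (L.map w).sum p = (L.map fun W => iterInt (γ p) T W 0).sum := by
        intro L
        induction L with
        | nil => rfl
        | cons W L ih => simp [← ih, w]
      rw [hp, ← hL _ (hγp p)]
      rfl
    change w I * w J ∈ Submodule.span ℝ (range w)
    rw [hw]
    refine list_sum_mem fun x hx => ?_
    obtain ⟨W, -, rfl⟩ := List.mem_map.1 hx
    exact Submodule.subset_span ⟨W, rfl⟩
  have hsep (p q : P) (hpq : ∀ a ∈ Submodule.span ℝ (range w), a p = a q) (i : ι) (u : ℝ)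
      (hu : u ∈ Icc 0 T) : γ p i u = γ q i u := by
    refine sub_eq_zero.1 (eq_zero_of_forall_integral_mul_pow_eq_zero
      ((hγp p i).sub (hγp q i)) hT (fun k => ?_) u hu)
    have h := hpq (w (i :: List.replicate k o)) (Submodule.subset_span ⟨_, rfl⟩)
    have hp (p : P) : w (i :: List.replicate k o) p =
        (∫ u in (0 : ℝ)..T, γ p i u * (T - u) ^ k) / k.factorial := by
      simp only [w, ContinuousMap.coe_mk, iterInt_cons, iterInt_replicate (ho p), mul_div_assoc']
      exact intervalIntegral.integral_div _ _
    rw [hp, hp, div_left_inj' (by positivity)] at h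
    simp only [Pi.sub_apply, sub_mul]
    have := hγp p i
    have := hγp q i
    rw [intervalIntegral.integral_sub (Continuous.intervalIntegrable (by fun_prop) _ _)
      (Continuous.intervalIntegrable (by fun_prop) _ _), h, sub_self]
  obtain ⟨a, ha, hfa⟩ := exists_mem_subalgebra_near_of_forall_eq
    (Submodule.toSubalgebra _ h_one h_mul) f (fun p q hpq => hf p q (hsep p q hpq)) hε
  obtain ⟨c, rfl⟩ := Finsupp.mem_span_range_iff_exists_finsupp.1 ha
  refine ⟨c, fun p => ?_⟩
  simpa [Finsupp.sum, ContinuousMap.sum_apply, w] using hfa p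

theorem deriv_timeAug {d : ℕ} {X : ℝ → Fin d → ℝ} (hX : Differentiable ℝ X) (i : Fin (d + 1)) :
    deriv (fun r => timeAug X r i) = fun u => (Fin.cons 1 (deriv X u) : Fin (d + 1) → ℝ) i := by
  ext u
  refine Fin.cases ?_ (fun j => ?_) i
  · simp [timeAug]
  · simpa [timeAug] using (hasDerivAt_pi.1 (hX u).hasDerivAt j).deriv

theorem toC1Data_eq_of_deriv_eq {d : ℕ} {T : ℝ} {X Y : C1Path d} (h0 : X.1 0 = Y.1 0)
    (h : ∀ u ∈ Icc 0 T, deriv X.1 u = deriv Y.1 u) : toC1Data d T X = toC1Data d T Y := by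
  have hX := X.2.differentiable one_ne_zero
  have hY := Y.2.differentiable one_ne_zero
  refine Prod.ext (ContinuousMap.ext fun u => ?_) (ContinuousMap.ext fun u => h u u.2)
  have hXY := intervalIntegral.integral_congr (μ := volume) (a := 0) (b := (u : ℝ)) fun v hv =>
    h v (by rw [uIcc_of_le u.2.1] at hv; exact ⟨hv.1, hv.2.trans u.2.2⟩)
  rw [intervalIntegral.integral_deriv_eq_sub (fun v _ => hX v)
      ((X.2.continuous_deriv le_rfl).intervalIntegrable _ _),
    intervalIntegral.integral_deriv_eq_sub (fun v _ => hY v)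
      ((Y.2.continuous_deriv le_rfl).intervalIntegrable _ _), h0] at hXY
  exact sub_left_injective hXY

/-- **First universal approximation theorem (time-augmented signatures).** Let `K` be a
compact set of `C¹` paths `X : [0,T] → ℝ^d` with common starting point `x₀`, in the `C¹`
topology, and let `f : K → ℝ` be continuous. Then for every `ε > 0` there are finitely
many multi-indices `I` over `{0,1,…,d}` and coefficients `ℓ_I` with
`sup_{X ∈ K} |f(X) − Σ_I ℓ_I S(X̂)^I_{0,T}| < ε`. -/
theorem first_universal_approximation {d : ℕ} (T : ℝ) (hT : 0 < T) (x₀ : Fin d → ℝ)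
    (K : Set (C1Path d)) (hK0 : ∀ X ∈ K, X.1 0 = x₀)
    (hKcompact : @IsCompact _ (pathTopology d T) K)
    (f : C1Path d → ℝ) (hf : @ContinuousOn _ _ (pathTopology d T) _ f K)
    (ε : ℝ) (hε : 0 < ε) :
    ∃ (s : Finset (List (Fin (d + 1)))) (ℓ : List (Fin (d + 1)) → ℝ),
      ∀ X ∈ K, |f X - ∑ I ∈ s, ℓ I * sigCoeff (timeAug X.1) 0 T I| < ε := by
  let _ : TopologicalSpace (C1Path d) := pathTopology d T
  have hind : IsInducing (toC1Data d T) := ⟨rfl⟩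
  have : CompactSpace K := isCompact_iff_compactSpace.1 hKcompact
  let γ (X : K) (i : Fin (d + 1)) (u : ℝ) : ℝ :=
    (Fin.cons 1 ((toC1Data d T X.1).2 (projIcc 0 T hT.le u)) : Fin (d + 1) → ℝ) i
  have hγT (X : K) (i : Fin (d + 1)) (u : ℝ) (hu : u ∈ Icc 0 T) :
      γ X i u = (Fin.cons 1 (deriv X.1.1 u) : Fin (d + 1) → ℝ) i := by
    simp only [γ, projIcc_of_mem _ hu]
    rfl
  have hdata : Continuous fun p : K × ℝ => (toC1Data d T p.1.1).2 (projIcc 0 T hT.le p.2) :=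
    ((hind.continuous.snd.comp continuous_subtype_val).comp continuous_fst).eval
      (continuous_projIcc.comp continuous_snd)
  have hγ (i : Fin (d + 1)) : Continuous fun p : K × ℝ => γ p.1 i p.2 :=
    Fin.cases continuous_const (fun j => (continuous_apply j).comp hdata) i
  have hfγ (X Y : K) (h : ∀ i, ∀ u ∈ Icc 0 T, γ X i u = γ Y i u) : f X = f Y := by
    have hXY : toC1Data d T X = toC1Data d T Y := by
      refine toC1Data_eq_of_deriv_eq ((hK0 _ X.2).trans (hK0 _ Y.2).symm) fun u hu => ?_
      ext j
      simpa [hγT _ _ u hu] using h j.succ u hu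
    have hins : Inseparable X Y :=
      IsInducing.subtypeVal.inseparable_iff.1 (hind.inseparable_iff.1 (.of_eq hXY))
    exact (hins.map hf.domRestrict).eq
  obtain ⟨c, hc⟩ := exists_sum_iterInt_near hγ (o := 0) (fun _ _ => rfl) hT
    ⟨K.domRestrict f, hf.domRestrict⟩ hfγ hε
  refine ⟨c.support, c, fun X hX => ?_⟩
  have hsig (I : List (Fin (d + 1))) :
      sigCoeff (timeAug X.1) 0 T I = iterInt (γ ⟨X, hX⟩) T I 0 := by
    have hd := deriv_timeAug (X.2.differentiable one_ne_zero)
    rw [sigCoeff_eq_iterInt (fun i => ?_) T I 0 hT.le]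
    · exact iterInt_congr (fun i u hu => by rw [hd, hγT _ _ _ hu]) I 0 ⟨le_rfl, hT.le⟩
    · rw [hd]
      exact Fin.cases continuous_const
        (fun j => (continuous_apply j).comp (X.2.continuous_deriv le_rfl)) i
  simp only [hsig]
  exact hc ⟨X, hX⟩
end

section
/- Fix x_0 ∈ ℝ^d, and let K be a compact set of continuously differentiable paths X : [0,T] → ℝ^d with X_0 = x_0, where the space of such paths carries the metric d(X,Y) = sup_{t∈[0,T]} ‖X_t − Y_t‖ + sup_{t∈[0,T]} ‖X'_t − Y'_t‖. Let f : K × [0,T] → ℝ be continuous and non-anticipative, i.e., f(X,t) = f(Y,t) whenever X_u = Y_u for all u ∈ [0,t]. Then for every ε > 0 there exist finitely many multi-indices I over the alphabet {0,1,…,d} and real coefficients ℓ_I such that sup_{X ∈ K, t ∈ [0,T]} | f(X,t) − Σ_I ℓ_I S(X̂)^I_{0,t} | < ε. (Second universal approximation theorem, for time-augmented signatures of stopped paths.) -/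
open MeasureTheory

open Set Filter Topology

/-- A linear span of functions on a compact space that contains the constants and is closed under
multiplication approximates uniformly every continuous function which is constant on the common
fibres of the spanning functions. -/
theorem exists_sum_near_of_constant_on_fibres {Z ι : Type*} [TopologicalSpace Z] [CompactSpace Z]
    (φ : ι → Z → ℝ) (hφ : ∀ i, Continuous (φ i))
    (h_one : (1 : Z → ℝ) ∈ Submodule.span ℝ (range φ))
    (h_mul : ∀ i j, φ i * φ j ∈ Submodule.span ℝ (range φ))
    (f : Z → ℝ) (hf : Continuous f) (hfib : ∀ z w, (∀ i, φ i z = φ i w) → f z = f w)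
    (ε : ℝ) (hε : 0 < ε) :
    ∃ (s : Finset ι) (ℓ : ι → ℝ), ∀ z, |f z - ∑ i ∈ s, ℓ i * φ i z| < ε := by
  let Φ : Z → range (fun z i => φ i z) := rangeFactorization (fun z i => φ i z)
  have hΦ : Continuous Φ := (continuous_pi fun i => hφ i).subtype_mk _
  have hcomp : CompactSpace (range (fun z i => φ i z)) :=
    isCompact_iff_compactSpace.1 (isCompact_range (continuous_pi fun i => hφ i))
  have hquot : IsQuotientMap Φ := hΦ.isClosedMap.isQuotientMap hΦ rangeFactorization_surjective
  let g : C(range (fun z i => φ i z), ℝ) := IsQuotientMap.lift (f := ⟨Φ, hΦ⟩) hquot ⟨f, hf⟩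
    fun z w h => hfib z w fun i => congr_fun (congr_arg Subtype.val h) i
  have hg : ∀ z, g (Φ z) = f z := fun z => DFunLike.congr_fun
    (IsQuotientMap.lift_comp (f := ⟨Φ, hΦ⟩) hquot ⟨f, hf⟩
      fun z w h => hfib z w fun i => congr_fun (congr_arg Subtype.val h) i) z
  let π : ι → C(range (fun z i => φ i z), ℝ) := fun i =>
    ⟨fun y => y.1 i, (continuous_apply i).comp continuous_subtype_val⟩
  obtain ⟨⟨p, hp⟩, hpg⟩ :=
    ContinuousMap.exists_mem_subalgebra_near_continuousMap_of_separatesPoints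
      (Algebra.adjoin ℝ (range π))
      (by
        intro y w hyw
        obtain ⟨i, hi⟩ : ∃ i, y.1 i ≠ w.1 i := by
          by_contra! h
          exact hyw (Subtype.ext (funext h))
        exact ⟨π i, ⟨π i, Algebra.subset_adjoin ⟨i, rfl⟩, rfl⟩, hi⟩) g ε hε
  have hspan_mul : ∀ u v, u ∈ Submodule.span ℝ (range φ) → v ∈ Submodule.span ℝ (range φ) →
      u * v ∈ Submodule.span ℝ (range φ) := by
    intro u v hu hv
    have : u * v ∈ Submodule.span ℝ (range φ) * Submodule.span ℝ (range φ) :=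
      Submodule.mul_mem_mul hu hv
    rw [Submodule.span_mul_span] at this
    refine Submodule.span_le.2 ?_ this
    rintro _ ⟨_, ⟨i, rfl⟩, _, ⟨j, rfl⟩, rfl⟩
    exact h_mul i j
  have hmem : (fun z => p (Φ z)) ∈ Submodule.span ℝ (range φ) := by
    clear hpg
    induction hp using Algebra.adjoin_induction with
    | mem x hx =>
      obtain ⟨i, rfl⟩ := hx
      exact Submodule.subset_span ⟨i, rfl⟩
    | algebraMap r =>
      convert Submodule.smul_mem _ r h_one using 1
      ext z
      simp
    | add x y _ _ hx hy => exact Submodule.add_mem _ hx hy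
    | mul x y _ _ hx hy => exact hspan_mul _ _ hx hy
  obtain ⟨c, hc⟩ := Finsupp.mem_span_range_iff_exists_finsupp.1 hmem
  refine ⟨c.support, c, fun z => ?_⟩
  have hz : ∑ i ∈ c.support, c i * φ i z = p (Φ z) := by
    rw [← congr_fun hc z]
    simp [Finsupp.sum]
  rw [hz, ← hg, abs_sub_comm]
  exact (ContinuousMap.norm_coe_le_norm (p - g) (Φ z)).trans_lt hpg

/-- The iterated integrals `∫_{a<u_n<⋯<u_1<t} x_{i_1}(u_1)⋯x_{i_n}(u_n) du` of a family of
functions, the head of the word being integrated last. -/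
noncomputable def iteratedIntegral {α : Type*} (x : α → ℝ → ℝ) (a : ℝ) : List α → ℝ → ℝ
  | [], _ => 1
  | i :: L, t => ∫ u in a..t, iteratedIntegral x a L u * x i u

section IteratedIntegral

variable {α : Type*}

theorem continuous_uncurry_iteratedIntegral {P : Type*} [TopologicalSpace P] (x : P → α → ℝ → ℝ)
    (hx : ∀ i, Continuous fun q : P × ℝ => x q.1 i q.2) (a : ℝ) (L : List α) :
    Continuous fun q : P × ℝ => iteratedIntegral (x q.1) a L q.2 := by
  induction L with
  | nil => exact continuous_const
  | cons i L ih =>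
    exact intervalIntegral.continuous_parametric_primitive_of_continuous
      (f := fun p u => iteratedIntegral (x p) a L u * x p i u) (ih.mul (hx i))

theorem continuous_iteratedIntegral (x : α → ℝ → ℝ) (hx : ∀ i, Continuous (x i)) (a : ℝ)
    (L : List α) : Continuous (iteratedIntegral x a L) :=
  (continuous_uncurry_iteratedIntegral (fun _ : Unit => x) (fun i => (hx i).comp continuous_snd)
    a L).comp (Continuous.prodMk_right ())

theorem hasDerivAt_iteratedIntegral_cons (x : α → ℝ → ℝ) (hx : ∀ i, Continuous (x i)) (a : ℝ)
    (i : α) (L : List α) (t : ℝ) :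
    HasDerivAt (iteratedIntegral x a (i :: L)) (iteratedIntegral x a L t * x i t) t :=
  ((continuous_iteratedIntegral x hx a L).mul (hx i)).integral_hasStrictDerivAt a t |>.hasDerivAt

theorem iteratedIntegral_congr (x y : α → ℝ → ℝ) {a b : ℝ}
    (h : ∀ i, EqOn (x i) (y i) (Icc a b)) (L : List α) :
    EqOn (iteratedIntegral x a L) (iteratedIntegral y a L) (Icc a b) := by
  induction L with
  | nil => exact fun _ _ => rfl
  | cons i L ih =>
    intro t ht
    refine intervalIntegral.integral_congr fun u hu => ?_
    rw [uIcc_of_le ht.1] at hu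
    have hu' : u ∈ Icc a b := ⟨hu.1, hu.2.trans ht.2⟩
    simp only [ih hu', h i hu']

theorem integral_sum_map_mul (x : α → ℝ → ℝ) (hx : ∀ i, Continuous (x i)) (a : ℝ) (i : α)
    (W : List (List α)) (t : ℝ) :
    ∫ u in a..t, (W.map fun L => iteratedIntegral x a L u).sum * x i u =
      ((W.map (List.cons i)).map fun L => iteratedIntegral x a L t).sum := by
  have hc : ∀ W : List (List α),
      Continuous fun u => (W.map fun L => iteratedIntegral x a L u).sum :=
    fun W => continuous_list_sum W fun L _ => continuous_iteratedIntegral x hx a L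
  induction W with
  | nil => simp
  | cons L W ih =>
    simp only [List.map_cons, List.sum_cons, add_mul]
    rw [intervalIntegral.integral_add, ih]
    · rfl
    · exact ((continuous_iteratedIntegral x hx a L).mul (hx i)).intervalIntegrable _ _
    · exact ((hc W).mul (hx i)).intervalIntegrable _ _

/-- The shuffle product of words, as a list of words with multiplicity. -/
def shuffleWords : List α → List α → List (List α)
  | [], M => [M]
  | i :: L, [] => [i :: L]
  | i :: L, j :: M =>
    (shuffleWords L (j :: M)).map (List.cons i) ++ (shuffleWords (i :: L) M).map (List.cons j)

theorem iteratedIntegral_mul (x : α → ℝ → ℝ) (hx : ∀ i, Continuous (x i)) (a : ℝ)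
    (L M : List α) (t : ℝ) :
    iteratedIntegral x a L t * iteratedIntegral x a M t =
      ((shuffleWords L M).map fun W => iteratedIntegral x a W t).sum := by
  induction L, M using shuffleWords.induct generalizing t with
  | case1 M => simp [shuffleWords, iteratedIntegral]
  | case2 i L => simp [shuffleWords, iteratedIntegral]
  | case3 i L j M ih₁ ih₂ =>
    have hL := continuous_iteratedIntegral x hx a
    have key := intervalIntegral.integral_mul_deriv_eq_deriv_mul
      (fun u _ => hasDerivAt_iteratedIntegral_cons x hx a i L u)
      (fun u _ => hasDerivAt_iteratedIntegral_cons x hx a j M u)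
      (((hL L).mul (hx i)).intervalIntegrable a t) (((hL M).mul (hx j)).intervalIntegrable a t)
    have h0 : iteratedIntegral x a (i :: L) a = 0 := intervalIntegral.integral_same
    rw [h0, zero_mul, sub_zero, eq_sub_iff_add_eq] at key
    rw [← key, shuffleWords, List.map_append, List.sum_append, ← integral_sum_map_mul x hx,
      ← integral_sum_map_mul x hx, add_comm]
    congr 1 <;> refine intervalIntegral.integral_congr fun u _ => ?_
    · simp only [← ih₁]; ring
    · simp only [← ih₂]; ring

theorem iteratedIntegral_replicate (x : α → ℝ → ℝ) (i : α) (hx : ∀ t, x i t = 1) (k : ℕ) (t : ℝ) :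
    iteratedIntegral x 0 (List.replicate k i) t = t ^ k / k.factorial := by
  induction k generalizing t with
  | zero => simp [iteratedIntegral]
  | succ k ih =>
    simp only [List.replicate_succ, iteratedIntegral, ih, hx, mul_one,
      intervalIntegral.integral_div, integral_pow, Nat.factorial_succ]
    push_cast
    field_simp
    simp

end IteratedIntegral

theorem eqOn_zero_of_integral_pow_mul_eq_zero {h : ℝ → ℝ} (hh : Continuous h) {a b : ℝ}
    (hab : a < b) (hpow : ∀ k : ℕ, ∫ u in a..b, u ^ k * h u = 0) : EqOn h 0 (Icc a b) := by
  have hpoly : ∀ p : Polynomial ℝ, ∫ u in a..b, p.eval u * h u = 0 := by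
    intro p
    induction p using Polynomial.induction_on' with
    | add p q hp hq =>
      simp only [Polynomial.eval_add, add_mul]
      rw [intervalIntegral.integral_add, hp, hq, add_zero] <;>
      exact ((Polynomial.continuous _).mul hh).intervalIntegrable _ _
    | monomial k c =>
      simp only [Polynomial.eval_monomial, mul_assoc, intervalIntegral.integral_const_mul, hpow,
        mul_zero]
  have hsq : ∫ u in a..b, h u ^ 2 = 0 := by
    have hle : ∀ ε > 0, ∫ u in a..b, h u ^ 2 ≤ ε * ∫ u in a..b, |h u| := by
      intro ε hε
      obtain ⟨p, hp⟩ := exists_polynomial_near_of_continuousOn a b h hh.continuousOn ε hε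
      have hsub : ∫ u in a..b, h u ^ 2 = ∫ u in a..b, (h u ^ 2 - p.eval u * h u) := by
        rw [intervalIntegral.integral_sub, hpoly, sub_zero]
        · exact (hh.pow 2).intervalIntegrable _ _
        · exact (p.continuous.mul hh).intervalIntegrable _ _
      rw [hsub, ← intervalIntegral.integral_const_mul]
      refine intervalIntegral.integral_mono_on hab.le
        (((hh.pow 2).sub (p.continuous.mul hh)).intervalIntegrable _ _)
        ((continuous_const.mul hh.abs).intervalIntegrable _ _) fun u hu => ?_
      calc h u ^ 2 - p.eval u * h u ≤ |(p.eval u - h u) * h u| := by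
            rw [← abs_neg]
            exact le_of_eq_of_le (by ring) (le_abs_self _)
        _ ≤ ε * |h u| := by
            rw [abs_mul]
            gcongr
            exact (hp u hu).le
    have hnn : 0 ≤ ∫ u in a..b, h u ^ 2 :=
      intervalIntegral.integral_nonneg hab.le fun u _ => sq_nonneg _
    refine le_antisymm ?_ hnn
    have hlim : Tendsto (fun ε : ℝ => ε * ∫ u in a..b, |h u|) (𝓝[>] 0) (𝓝 0) := by
      have : Tendsto (fun ε : ℝ => ε * ∫ u in a..b, |h u|) (𝓝 0) (𝓝 (0 * ∫ u in a..b, |h u|)) :=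
        tendsto_id.mul_const _
      rw [zero_mul] at this
      exact this.mono_left nhdsWithin_le_nhds
    exact ge_of_tendsto hlim (eventually_mem_nhdsWithin.mono hle)
  intro u hu
  by_contra hne
  exact (intervalIntegral.integral_pos hab (hh.pow 2).continuousOn (fun v _ => sq_nonneg (h v))
    ⟨u, hu, sq_pos_of_ne_zero hne⟩).ne' hsq

section Simplex

/-- The ordered simplex `{s < u_1 < ⋯ < u_n < t}`. -/
def orderedSimplex (n : ℕ) (s t : ℝ) : Set (Fin n → ℝ) :=
  {u | (∀ a b : Fin n, a < b → u a < u b) ∧ ∀ a, u a ∈ Ioo s t}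

theorem measurableSet_orderedSimplex (n : ℕ) (s t : ℝ) :
    MeasurableSet (orderedSimplex n s t) := by
  simp only [orderedSimplex, ofPred_and, ofPred_forall]
  refine .inter (.iInter fun a => .iInter fun b => .iInter fun _ =>
    measurableSet_lt (measurable_pi_apply a) (measurable_pi_apply b))
    (.iInter fun a => measurable_pi_apply a measurableSet_Ioo)

theorem snoc_mem_orderedSimplex_iff {n : ℕ} {s t x : ℝ} {v : Fin n → ℝ} :
    (Fin.snoc v x : Fin (n + 1) → ℝ) ∈ orderedSimplex (n + 1) s t ↔
      x ∈ Ioo s t ∧ v ∈ orderedSimplex n s x := by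
  simp only [orderedSimplex, mem_ofPred_eq, Fin.forall_fin_succ', Fin.snoc_castSucc, Fin.snoc_last,
    Fin.castSucc_lt_castSucc_iff, Fin.castSucc_lt_last, lt_self_iff_false, forall_const, mem_Ioo,
    (Fin.le_last _).not_gt]
  constructor
  · rintro ⟨⟨h, -⟩, h₃, h₄⟩
    exact ⟨h₄, fun a => (h a).1, fun a => ⟨(h₃ a).1, (h a).2⟩⟩
  · rintro ⟨h₄, h, h₃⟩
    exact ⟨⟨fun a => ⟨h a, (h₃ a).2⟩, by simp⟩, fun a => ⟨(h₃ a).1, (h₃ a).2.trans h₄.2⟩, h₄⟩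

theorem integrableOn_orderedSimplex {n : ℕ} {F : (Fin n → ℝ) → ℝ} (hF : Continuous F) (s t : ℝ) :
    IntegrableOn F (orderedSimplex n s t) :=
  (hF.continuousOn.integrableOn_compact (isCompact_univ_pi fun _ => isCompact_Icc)).mono_set
    fun _ hu a _ => Ioo_subset_Icc_self (hu.2 a)

theorem integral_orderedSimplex_succ {n : ℕ} (g : Fin (n + 1) → ℝ → ℝ)
    (hg : ∀ a, Continuous (g a)) {s t : ℝ} (hst : s ≤ t) :
    ∫ u in orderedSimplex (n + 1) s t, ∏ a, g a (u a) =
      ∫ x in s..t, (∫ v in orderedSimplex n s x, ∏ a, g a.castSucc (v a)) * g (Fin.last n) x := by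
  let e := MeasurableEquiv.piFinSuccAbove (fun _ : Fin (n + 1) => ℝ) (Fin.last n)
  have he : MeasurePreserving e.symm :=
    (volume_preserving_piFinSuccAbove (fun _ : Fin (n + 1) => ℝ) (Fin.last n)).symm _
  have hsnoc : ∀ x v, e.symm (x, v) = Fin.snoc v x := fun x v => Fin.insertNth_last' x v
  have hint : Integrable ((orderedSimplex (n + 1) s t).indicator fun u => ∏ a, g a (u a)) :=
    (integrable_indicator_iff (measurableSet_orderedSimplex _ _ _)).2
      (integrableOn_orderedSimplex (by fun_prop) _ _)
  rw [← integral_indicator (measurableSet_orderedSimplex _ _ _), ← he.integral_comp',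
    Measure.volume_eq_prod,
    integral_prod (fun p => indicator _ _ (e.symm p)) (he.integrable_comp_of_integrable hint),
    intervalIntegral.integral_of_le hst, integral_Ioc_eq_integral_Ioo,
    ← integral_indicator measurableSet_Ioo]
  congr 1 with x
  simp only [hsnoc]
  by_cases hx : x ∈ Ioo s t
  · rw [indicator_of_mem hx, ← integral_mul_const,
      ← integral_indicator (measurableSet_orderedSimplex _ _ _)]
    congr 1 with v
    by_cases hv : v ∈ orderedSimplex n s x
    · rw [indicator_of_mem hv, indicator_of_mem (snoc_mem_orderedSimplex_iff.2 ⟨hx, hv⟩),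
        Fin.prod_univ_castSucc]
      simp
    · rw [indicator_of_notMem hv,
        indicator_of_notMem fun h => hv (snoc_mem_orderedSimplex_iff.1 h).2]
  · rw [indicator_of_notMem hx]
    refine integral_eq_zero_of_ae (.of_forall fun v => ?_)
    exact indicator_of_notMem (fun h => hx (snoc_mem_orderedSimplex_iff.1 h).1) _

theorem integral_orderedSimplex_eq_iteratedIntegral {α : Type*} (x : α → ℝ → ℝ)
    (hx : ∀ i, Continuous (x i)) (s : ℝ) (n : ℕ) (w : Fin n → α) {t : ℝ} (hst : s ≤ t) :
    ∫ u in orderedSimplex n s t, ∏ a, x (w a) (u a) =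
      iteratedIntegral x s (List.ofFn w).reverse t := by
  induction n generalizing t with
  | zero =>
    have : orderedSimplex 0 s t = univ :=
      eq_univ_of_forall fun u => ⟨fun a => a.elim0, fun a => a.elim0⟩
    simp [this, iteratedIntegral, volume_pi, Measure.real, Measure.pi_empty_univ]
  | succ n ih =>
    rw [integral_orderedSimplex_succ (fun a => x (w a)) (fun a => hx _) hst, List.ofFn_succ',
      List.concat_eq_append, List.reverse_append]
    refine intervalIntegral.integral_congr fun u hu => ?_
    rw [uIcc_of_le hst] at hu
    simp only [ih (fun a => w a.castSucc) hu.1]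
    rfl

end Simplex

theorem sigCoeff_eq_iteratedIntegral {d : ℕ} (X : ℝ → Fin d → ℝ)
    (hX : ∀ i, Continuous (deriv fun r => X r i)) {s t : ℝ} (hst : s ≤ t) (I : List (Fin d)) :
    sigCoeff X s t I = iteratedIntegral (fun i => deriv fun r => X r i) s I.reverse t := by
  rw [← List.ofFn_get I, ← integral_orderedSimplex_eq_iteratedIntegral _ hX _ _ _ hst,
    List.ofFn_get]
  rfl

/-- The derivative of a time-augmented path on `[0,T]`, extended to `ℝ` by constants. -/
noncomputable def augDeriv {d : ℕ} {T : ℝ} (hT : 0 ≤ T) (p : C(Icc (0 : ℝ) T, Fin d → ℝ)) :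
    Fin (d + 1) → ℝ → ℝ :=
  fun i u => (Fin.cons 1 (p (projIcc 0 T hT u)) : Fin (d + 1) → ℝ) i

section AugDeriv

variable {d : ℕ} {T : ℝ}

@[simp]
theorem augDeriv_zero (hT : 0 ≤ T) (p : C(Icc (0 : ℝ) T, Fin d → ℝ)) (u : ℝ) :
    augDeriv hT p 0 u = 1 := rfl

@[simp]
theorem augDeriv_succ (hT : 0 ≤ T) (p : C(Icc (0 : ℝ) T, Fin d → ℝ)) (j : Fin d) (u : ℝ) :
    augDeriv hT p j.succ u = p (projIcc 0 T hT u) j := rfl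

theorem continuous_uncurry_augDeriv (hT : 0 ≤ T) (i : Fin (d + 1)) :
    Continuous fun q : C(Icc (0 : ℝ) T, Fin d → ℝ) × ℝ => augDeriv hT q.1 i q.2 := by
  induction i using Fin.cases with
  | zero => exact continuous_const
  | succ j =>
    simp only [augDeriv_succ]
    exact (continuous_apply j).comp (continuous_eval.comp
      (continuous_fst.prodMk ((continuous_projIcc (h := hT)).comp continuous_snd)))

theorem continuous_augDeriv (hT : 0 ≤ T) (p : C(Icc (0 : ℝ) T, Fin d → ℝ)) (i : Fin (d + 1)) :
    Continuous (augDeriv hT p i) :=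
  (continuous_uncurry_augDeriv hT i).comp (Continuous.prodMk_right p)

theorem deriv_timeAug_zero (X : ℝ → Fin d → ℝ) :
    deriv (fun r => timeAug X r 0) = fun _ => 1 :=
  deriv_id'

theorem deriv_timeAug_succ {X : ℝ → Fin d → ℝ} (hX : ContDiff ℝ 1 X) (j : Fin d) :
    deriv (fun r => timeAug X r j.succ) = fun u => deriv X u j := by
  ext u
  exact (hasDerivAt_pi.1 (hX.differentiable one_ne_zero u).hasDerivAt j).deriv

theorem sigCoeff_timeAug (hT : 0 ≤ T) (X : C1Path d) {t : ℝ} (ht : t ∈ Icc (0 : ℝ) T)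
    (I : List (Fin (d + 1))) :
    sigCoeff (timeAug X.1) 0 t I =
      iteratedIntegral (augDeriv hT (toC1Data d T X).2) 0 I.reverse t := by
  rw [sigCoeff_eq_iteratedIntegral _ _ ht.1]
  · refine iteratedIntegral_congr _ _ (b := T) (fun i u hu => ?_) _ ht
    induction i using Fin.cases with
    | zero => simp [deriv_timeAug_zero]
    | succ j => simp [deriv_timeAug_succ X.2, toC1Data, projIcc_of_mem hT hu]
  · intro i
    induction i using Fin.cases with
    | zero => simpa only [deriv_timeAug_zero] using continuous_const
    | succ j =>
      rw [deriv_timeAug_succ X.2]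
      exact (continuous_apply j).comp (X.2.continuous_deriv le_rfl)

theorem eqOn_augDeriv_of_iteratedIntegral_eq (hT : 0 ≤ T)
    {p q : C(Icc (0 : ℝ) T, Fin d → ℝ)} {t : ℝ} (ht : 0 < t)
    (h : ∀ I, iteratedIntegral (augDeriv hT p) 0 I t = iteratedIntegral (augDeriv hT q) 0 I t)
    (j : Fin d) : EqOn (augDeriv hT p j.succ) (augDeriv hT q j.succ) (Icc 0 t) := by
  have hp := continuous_augDeriv hT p j.succ
  have hq := continuous_augDeriv hT q j.succ
  intro u hu
  refine sub_eq_zero.1 (eqOn_zero_of_integral_pow_mul_eq_zero (hp.sub hq) ht (fun k => ?_) hu)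
  have hk := h (j.succ :: List.replicate k 0)
  simp only [iteratedIntegral, iteratedIntegral_replicate _ 0 (augDeriv_zero hT _),
    div_mul_eq_mul_div, intervalIntegral.integral_div] at hk
  rw [div_left_inj' (by positivity)] at hk
  simp only [Pi.sub_apply, mul_sub]
  rw [intervalIntegral.integral_sub, hk, sub_self]
  · exact ((continuous_id.pow k).mul hp).intervalIntegrable _ _
  · exact ((continuous_id.pow k).mul hq).intervalIntegrable _ _

theorem eqOn_of_iteratedIntegral_augDeriv_eq (hT : 0 ≤ T) {X Y : C1Path d} (h0 : X.1 0 = Y.1 0)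
    {t : ℝ} (ht : t ∈ Icc (0 : ℝ) T)
    (h : ∀ I, iteratedIntegral (augDeriv hT (toC1Data d T X).2) 0 I t =
      iteratedIntegral (augDeriv hT (toC1Data d T Y).2) 0 I t) :
    EqOn X.1 Y.1 (Icc 0 t) := by
  intro u hu
  have hsub : ∀ Z : C1Path d, ∫ v in (0 : ℝ)..u, deriv Z.1 v = Z.1 u - Z.1 0 := fun Z =>
    intervalIntegral.integral_deriv_eq_sub (fun v _ => Z.2.differentiable one_ne_zero v)
      ((Z.2.continuous_deriv le_rfl).intervalIntegrable _ _)
  have hderiv : ∫ v in (0 : ℝ)..u, deriv X.1 v = ∫ v in (0 : ℝ)..u, deriv Y.1 v := by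
    refine intervalIntegral.integral_congr_Ioo_of_le hu.1 fun v hv => funext fun j => ?_
    have hvt : v ∈ Icc 0 t := ⟨hv.1.le, hv.2.le.trans hu.2⟩
    have := eqOn_augDeriv_of_iteratedIntegral_eq hT (hv.1.trans_le hvt.2) h j hvt
    simpa [toC1Data, projIcc_of_mem hT ⟨hvt.1, hvt.2.trans ht.2⟩] using this
  rw [hsub, hsub, h0] at hderiv
  exact sub_left_injective hderiv

end AugDeriv

/-- **Second universal approximation theorem (stopped time-augmented signatures).**
Let `K` be a compact set of `C¹` paths `X : [0,T] → ℝ^d` with common starting point `x₀`,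
in the `C¹` topology, and let `f : K × [0,T] → ℝ` be continuous and non-anticipative
(`f(X,t) = f(Y,t)` whenever `X = Y` on `[0,t]`). Then for every `ε > 0` there are finitely
many multi-indices `I` over `{0,1,…,d}` and coefficients `ℓ_I` with
`sup_{X ∈ K, t ∈ [0,T]} |f(X,t) − Σ_I ℓ_I S(X̂)^I_{0,t}| < ε`. -/
theorem second_universal_approximation {d : ℕ} (T : ℝ) (hT : 0 < T) (x₀ : Fin d → ℝ)
    (K : Set (C1Path d)) (hK0 : ∀ X ∈ K, X.1 0 = x₀)
    (hKcompact : @IsCompact _ (pathTopology d T) K)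
    (f : C1Path d → ℝ → ℝ)
    (hf : @ContinuousOn _ _ (@instTopologicalSpaceProd _ _ (pathTopology d T) inferInstance) _
      (fun q => f q.1 q.2) (K ×ˢ Set.Icc (0:ℝ) T))
    (hna : ∀ X ∈ K, ∀ Y ∈ K, ∀ t ∈ Set.Icc (0:ℝ) T,
      (∀ u ∈ Set.Icc (0:ℝ) t, X.1 u = Y.1 u) → f X t = f Y t)
    (ε : ℝ) (hε : 0 < ε) :
    ∃ (s : Finset (List (Fin (d + 1)))) (ℓ : List (Fin (d + 1)) → ℝ),
      ∀ X ∈ K, ∀ t ∈ Set.Icc (0:ℝ) T,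
        |f X t - ∑ I ∈ s, ℓ I * sigCoeff (timeAug X.1) 0 t I| < ε := by
  let _ : TopologicalSpace (C1Path d) := pathTopology d T
  have hcomp : CompactSpace ↥(K ×ˢ Icc (0 : ℝ) T) :=
    isCompact_iff_compactSpace.1 (hKcompact.prod isCompact_Icc)
  have hdata : Continuous (toC1Data d T) := continuous_induced_dom
  let φ : List (Fin (d + 1)) → ↥(K ×ˢ Icc (0 : ℝ) T) → ℝ := fun I z =>
    sigCoeff (timeAug z.1.1.1) 0 z.1.2 I
  have hφ : ∀ I z, φ I z =
      iteratedIntegral (augDeriv hT.le (toC1Data d T z.1.1).2) 0 I.reverse z.1.2 :=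
    fun I z => sigCoeff_timeAug hT.le z.1.1 z.2.2 I
  have hcont : ∀ I, Continuous (φ I) := fun I => by
    simp only [funext (hφ I)]
    exact (continuous_uncurry_iteratedIntegral (fun p => augDeriv hT.le p)
      (continuous_uncurry_augDeriv hT.le) 0 I.reverse).comp
      (((hdata.comp (continuous_fst.comp continuous_subtype_val)).snd).prodMk
        (continuous_snd.comp continuous_subtype_val))
  suffices ∃ (s : Finset (List (Fin (d + 1)))) (ℓ : List (Fin (d + 1)) → ℝ),
      ∀ z : ↥(K ×ˢ Icc (0 : ℝ) T), |f z.1.1 z.1.2 - ∑ I ∈ s, ℓ I * φ I z| < ε by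
    obtain ⟨s, ℓ, h⟩ := this
    exact ⟨s, ℓ, fun X hX t ht => h ⟨(X, t), hX, ht⟩⟩
  refine exists_sum_near_of_constant_on_fibres φ hcont ?_ ?_
    (fun z => f z.1.1 z.1.2) (continuousOn_iff_continuous_domRestrict.1 hf) ?_ ε hε
  · refine Submodule.subset_span ⟨[], funext fun z => ?_⟩
    rw [hφ]
    rfl
  · intro I J
    have hmul : φ I * φ J = ((shuffleWords I.reverse J.reverse).map fun W => φ W.reverse).sum := by
      ext z
      rw [Pi.mul_apply, hφ, hφ, iteratedIntegral_mul _ (continuous_augDeriv hT.le _)]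
      simp [Pi.list_sum_apply, Function.comp_def, hφ]
    rw [hmul]
    refine list_sum_mem ?_
    simp only [List.mem_map]
    rintro _ ⟨W, -, rfl⟩
    exact Submodule.subset_span ⟨_, rfl⟩
  · rintro ⟨⟨X, t⟩, hX, ht⟩ ⟨⟨Y, s⟩, hY, hs⟩ h
    simp only [hφ] at h
    obtain rfl : t = s := by simpa [iteratedIntegral] using h [0]
    refine hna X hX Y hY t ht (eqOn_of_iteratedIntegral_augDeriv_eq hT.le
      ((hK0 X hX).trans (hK0 Y hY).symm) ht fun I => ?_)
    simpa using h I.reverse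
end

section
/- Let X : [0,T] → ℝ^d be a continuously differentiable path. For every (s,t) with 0 ≤ s ≤ t ≤ T, every k ≥ 1, and every multi-index I ∈ {1,…,d}^k, the signature coefficient satisfies the factorial decay estimate |S(X)^I_{s,t}| ≤ (∫_s^t ‖X'(u)‖ du)^k / k!, where ‖·‖ is the Euclidean norm on ℝ^d. -/
open MeasureTheory

/-- The signature coefficient `S(X)^I_{s,t}` of a path `X : ℝ → ℝ^d` (with `ℝ^d` carrying
the Euclidean norm) over `[s,t]`, for a multi-index (word) `I = (i_1,…,i_n)`: the iterated
integral `∫_{s<u_1<⋯<u_n<t} X'_{i_1}(u_1)⋯X'_{i_n}(u_n) du`. -/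
noncomputable def sigCoeffE {d : ℕ} (X : ℝ → EuclideanSpace ℝ (Fin d)) (s t : ℝ)
    (I : List (Fin d)) : ℝ :=
  ∫ u in {u : Fin I.length → ℝ |
      (∀ a b : Fin I.length, a < b → u a < u b) ∧ ∀ a, u a ∈ Set.Ioo s t},
    ∏ a : Fin I.length, deriv (fun r => X r (I.get a)) (u a)

/-- The set of strictly increasing tuples is measurable. -/
theorem measurableSet_setOf_strictMono (n : ℕ) :
    MeasurableSet {u : Fin n → ℝ | StrictMono u} := by
  have h : {u : Fin n → ℝ | StrictMono u} =
      ⋂ a : Fin n, ⋂ b : Fin n, ⋂ _ : a < b, {u | u a < u b} := by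
    ext u
    simp [StrictMono]
  rw [h]
  exact .iInter fun a => .iInter fun b => .iInter fun _ =>
    measurableSet_lt (measurable_pi_apply a) (measurable_pi_apply b)

/-- The permuted open simplices `{u | u ∘ σ strictly increasing}` are pairwise disjoint. -/
theorem pairwise_disjoint_setOf_strictMono_comp (n : ℕ) :
    Pairwise (Function.onFun Disjoint
      fun σ : Equiv.Perm (Fin n) => {u : Fin n → ℝ | StrictMono (u ∘ σ)}) := by
  intro σ τ hne
  refine Set.disjoint_left.2 fun u hσ hτ => hne ?_
  have hmono : StrictMono (σ⁻¹ * τ) := fun a b hab =>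
    hσ.lt_iff_lt.1 (by simpa using hτ hab)
  have hid : ⇑(σ⁻¹ * τ) = id := by
    have h := Subsingleton.elim (hmono.orderIsoOfSurjective _ (σ⁻¹ * τ).surjective)
      (OrderIso.refl (Fin n))
    funext a
    exact congrArg (fun e : Fin n ≃o Fin n => e a) h
  exact inv_mul_eq_one.1 (Equiv.ext fun a => congrFun hid a)

/-- The integral of a product `∏ f (u a)` over the increasing simplex is at most
`(∫ f) ^ n / n!`. -/
theorem setIntegral_strictMono_prod_le {f : ℝ → ℝ} (hf : Integrable f) (hf0 : ∀ x, 0 ≤ f x)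
    (n : ℕ) :
    ∫ u in {u : Fin n → ℝ | StrictMono u}, ∏ a, f (u a) ≤
      (∫ x, f x) ^ n / (Nat.factorial n : ℝ) := by
  have hint : Integrable fun u : Fin n → ℝ => ∏ a, f (u a) :=
    Integrable.fintype_prod fun _ => hf
  have hpres (σ : Equiv.Perm (Fin n)) :
      MeasurePreserving (MeasurableEquiv.piCongrLeft (fun _ : Fin n => ℝ) σ⁻¹) :=
    volume_measurePreserving_piCongrLeft _ _
  have happly (σ : Equiv.Perm (Fin n)) (u : Fin n → ℝ) :
      MeasurableEquiv.piCongrLeft (fun _ : Fin n => ℝ) σ⁻¹ u = u ∘ σ := by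
    funext a
    have h := Equiv.piCongrLeft_apply_apply (fun _ : Fin n => ℝ) σ⁻¹ u (σ a)
    simpa [MeasurableEquiv.coe_piCongrLeft] using h
  have hpre (σ : Equiv.Perm (Fin n)) : {u : Fin n → ℝ | StrictMono (u ∘ σ)} =
      MeasurableEquiv.piCongrLeft (fun _ : Fin n => ℝ) σ⁻¹ ⁻¹' {u | StrictMono u} := by
    ext u
    simp only [Set.mem_preimage, Set.mem_ofPred_eq, happly]
  have hmeas (σ : Equiv.Perm (Fin n)) :
      MeasurableSet {u : Fin n → ℝ | StrictMono (u ∘ σ)} := by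
    rw [hpre]
    exact (MeasurableEquiv.measurable _) (measurableSet_setOf_strictMono n)
  have hperm (σ : Equiv.Perm (Fin n)) :
      ∫ u in {u : Fin n → ℝ | StrictMono (u ∘ σ)}, ∏ a, f (u a) =
        ∫ u in {u : Fin n → ℝ | StrictMono u}, ∏ a, f (u a) := by
    rw [hpre, ← (hpres σ).setIntegral_preimage_emb (MeasurableEquiv.measurableEmbedding _)
      (fun u => ∏ a, f (u a)) {u | StrictMono u}]
    refine integral_congr_ae (.of_forall fun u => ?_)
    simp only [happly, Function.comp_apply]
    exact (Equiv.prod_comp σ fun a => f (u a)).symm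
  rw [le_div_iff₀' (by positivity)]
  calc (Nat.factorial n : ℝ) * ∫ u in {u : Fin n → ℝ | StrictMono u}, ∏ a, f (u a)
      = ∑ σ : Equiv.Perm (Fin n),
          ∫ u in {u : Fin n → ℝ | StrictMono (u ∘ σ)}, ∏ a, f (u a) := by
        simp [hperm, Fintype.card_perm]
    _ = ∫ u in ⋃ σ : Equiv.Perm (Fin n), {u : Fin n → ℝ | StrictMono (u ∘ σ)},
          ∏ a, f (u a) :=
        (integral_iUnion_fintype hmeas (pairwise_disjoint_setOf_strictMono_comp n)
          fun _ => hint.integrableOn).symm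
    _ ≤ ∫ u : Fin n → ℝ, ∏ a, f (u a) :=
        setIntegral_le_integral hint (.of_forall fun u => Finset.prod_nonneg fun a _ => hf0 _)
    _ = (∫ x, f x) ^ n := by
        rw [integral_fintype_prod_volume_eq_pow, Fintype.card_fin]

/-- **Factorial decay of signature coefficients.** For a continuously differentiable path
`X : [0,T] → ℝ^d`, every `0 ≤ s ≤ t ≤ T`, every `k ≥ 1` and every multi-index `I` of
length `k`, `|S(X)^I_{s,t}| ≤ (∫_s^t ‖X'(u)‖ du)^k / k!`, with `‖·‖` the Euclidean norm. -/
theorem signature_factorial_decay {d : ℕ} (T : ℝ) (hT : 0 ≤ T)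
    (X : ℝ → EuclideanSpace ℝ (Fin d)) (hX : ContDiff ℝ 1 X)
    (s t : ℝ) (hs : 0 ≤ s) (hst : s ≤ t) (htT : t ≤ T)
    (I : List (Fin d)) (hI : 1 ≤ I.length) :
    |sigCoeffE X s t I| ≤
      (∫ u in s..t, ‖deriv X u‖) ^ I.length / (Nat.factorial I.length : ℝ) := by
  set f : ℝ → ℝ := (Set.Ioo s t).indicator fun u => ‖deriv X u‖ with hf_def
  have hf0 (x : ℝ) : 0 ≤ f x := Set.indicator_nonneg (fun _ _ => norm_nonneg _) x
  have hf : Integrable f :=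
    ((((hX.continuous_deriv le_rfl).norm.integrableOn_Icc (a := s) (b := t)).mono_set
      Set.Ioo_subset_Icc_self).integrable_indicator measurableSet_Ioo)
  have hfint : ∫ x, f x = ∫ u in s..t, ‖deriv X u‖ := by
    rw [hf_def, integral_indicator measurableSet_Ioo, intervalIntegral.integral_of_le hst,
      integral_Ioc_eq_integral_Ioo]
  have hcoord (i : Fin d) (x : ℝ) : |deriv (fun r => X r i) x| ≤ ‖deriv X x‖ := by
    have hd := (hX.differentiable one_ne_zero x).hasDerivAt
    have hdi : HasDerivAt (fun r => X r i) (deriv X x i) x :=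
      (EuclideanSpace.proj i : EuclideanSpace ℝ (Fin d) →L[ℝ] ℝ).hasFDerivAt.comp_hasDerivAt x hd
    rw [hdi.deriv]
    exact PiLp.norm_apply_le (deriv X x) i
  have hint : Integrable fun u : Fin I.length → ℝ => ∏ a, f (u a) :=
    Integrable.fintype_prod fun _ => hf
  have hset : MeasurableSet {u : Fin I.length → ℝ |
      (∀ a b : Fin I.length, a < b → u a < u b) ∧ ∀ a, u a ∈ Set.Ioo s t} := by
    have h := (measurableSet_setOf_strictMono I.length).inter
      (MeasurableSet.univ_pi fun _ : Fin I.length => measurableSet_Ioo (a := s) (b := t))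
    convert h using 1
    ext u
    simp [StrictMono]
  calc |sigCoeffE X s t I|
      ≤ ∫ u in {u : Fin I.length → ℝ |
          (∀ a b : Fin I.length, a < b → u a < u b) ∧ ∀ a, u a ∈ Set.Ioo s t},
          ∏ a, f (u a) := by
        refine norm_integral_le_of_norm_le (G := ℝ) hint.integrableOn
          (ae_restrict_of_forall_mem hset fun u hu => ?_)
        rw [norm_prod]
        refine Finset.prod_le_prod (fun _ _ => norm_nonneg _) fun a _ => ?_
        rw [hf_def, Set.indicator_of_mem (hu.2 a)]
        exact hcoord _ _
    _ ≤ ∫ u in {u : Fin I.length → ℝ | StrictMono u}, ∏ a, f (u a) :=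
        setIntegral_mono_set hint.integrableOn
          (.of_forall fun u => Finset.prod_nonneg fun a _ => hf0 _)
          (.of_forall fun u hu a b hab => hu.1 a b hab)
    _ ≤ (∫ x, f x) ^ I.length / (Nat.factorial I.length : ℝ) :=
        setIntegral_strictMono_prod_le hf hf0 _
    _ = _ := by rw [hfint]
end
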